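/- Let s ≥ 1, let α ∈ ℕ with α ≥ 2, and let f : [0,1]^s → ℝ be a function whose mixed partial derivatives up to order α in each variable are continuous on [0,1]^s. Let 1 ≤ p, q, q' ≤ ∞ with 1/q + 1/q' = 1, and let (γ_v)_{∅≠v⊆S} be positive real weights, where S = {1,…,s}. Let P be a digital net over 𝔽₂ with |P| = 2^m. Then |∫_{[0,1)^s} f(x) dx − 2^{−m} ∑_{x∈P} f(x)| ≤ ‖f‖_{B_α,γ,p,q'} · W_{α,γ,q}(P), where W_{α,γ,q}(P) = ( ∑_{∅≠v⊆S} ( γ_v ∑_{k_v ∈ P_v^⊥} 2^{−μ'_α(k_v)} )^q )^{1/q} and ‖f‖_{B_α,γ,p,q'} = ( ∑_{∅≠v⊆S} ( γ_v^{−1} 2^{|v|/p} sup_{α_v ∈ {1,…,α}^{|v|}} ‖f^{(α_v)}‖_p )^{q'} )^{1/q'}, with the usual modifications if p, q or q' is infinite. -/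

import Mathlib

open MeasureTheory Finset
open scoped ENNReal

noncomputable section

/-- The `j`-th binary digit (`j ≥ 1`) of a real number `x ∈ [0,1)`
(using the binary expansion in which infinitely many digits are `0`). -/
def bdigit (x : ℝ) (j : ℕ) : ℕ := ⌊x * 2 ^ j⌋.toNat % 2

/-- The `k`-th (dyadic) Walsh function. -/
def walsh (k : ℕ) (x : ℝ) : ℝ :=
  (-1 : ℝ) ^ (∑ j ∈ Finset.range k, if k.testBit j then bdigit x (j + 1) else 0)

/-- The multi-dimensional Walsh function. -/
def walshV {s : ℕ} (k : Fin s → ℕ) (x : Fin s → ℝ) : ℝ := ∏ i, walsh (k i) (x i)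

/-- The half-open unit cube `[0,1)^s`. -/
def unitCube (s : ℕ) : Set (Fin s → ℝ) := Set.univ.pi fun _ => Set.Ico (0 : ℝ) 1

/-- The closed unit cube `[0,1]^s`. -/
def closedCube (s : ℕ) : Set (Fin s → ℝ) := Set.univ.pi fun _ => Set.Icc (0 : ℝ) 1

/-- The `k`-th Walsh coefficient of `f`. -/
def walshCoeff {s : ℕ} (f : (Fin s → ℝ) → ℝ) (k : Fin s → ℕ) : ℝ :=
  ∫ x in unitCube s, f x * walshV k x

/-- `z ⊕ 2^{-n}` : flipping the `n`-th binary digit of `z`. -/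
def oplus (z : ℝ) (n : ℕ) : ℝ := z + (-1) ^ bdigit z n * ((2 : ℝ) ^ n)⁻¹

/-- The dyadic difference `∂_{i,n}`. -/
def dyadicDiff {s : ℕ} (i : Fin s) (n : ℕ) (g : (Fin s → ℝ) → ℝ) (x : Fin s → ℝ) : ℝ :=
  2 ^ n * (g (Function.update x i (oplus (x i) n)) - g x)

/-- The function `χ_n`. -/
def chi (n : ℕ) (x y : ℝ) : ℝ :=
  if min x (oplus x n) ≤ y ∧ y ≤ max x (oplus x n) then 2 ^ n else 0

/-- The exponents in the binary expansion of `k`, in decreasing order. -/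
def bitsDesc (k : ℕ) : List ℕ := ((List.range k).filter fun j => k.testBit j).reverse

/-- The number `N` of nonzero binary digits of `k`. -/
def numBits (k : ℕ) : ℕ := (bitsDesc k).length

/-- The weight `μ'_u(k) = ∑_{j=1}^{min(u,N)} (a_j + 2)` for scalar `k`. -/
def muW (u k : ℕ) : ℕ := (((bitsDesc k).take u).map (· + 2)).sum

/-- The weight `μ'_u(k)` for vectors. -/
def muWV {s : ℕ} (u k : Fin s → ℕ) : ℕ := ∑ i, muW (u i) (k i)

/-- `k_{≤}^{u}` : the `u` most significant binary digits of `k`. -/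
def kLe (u k : ℕ) : ℕ := (((bitsDesc k).take u).map (2 ^ ·)).sum

/-- `k_{>}^{u}` : the remaining binary digits of `k`. -/
def kGt (u k : ℕ) : ℕ := (((bitsDesc k).drop u).map (2 ^ ·)).sum

/-- The functions `W(k)`, defined inductively by stripping the least significant
binary digit of `k` (whose exponent is the 2-adic valuation of `k`). -/
def Wfun : ℕ → ℝ → ℝ
  | 0 => fun _ => 1
  | (k + 1) => fun y =>
      ∫ x in Set.Ico (0 : ℝ) 1,
        chi ((k + 1).factorization 2 + 1) x y *
          Wfun ((k + 1) - 2 ^ ((k + 1).factorization 2)) x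
  decreasing_by exact Nat.sub_lt (Nat.succ_pos k) (Nat.two_pow_pos _)

/-- Composition of the dyadic differences `∂_{i,a+1}` for `a` running over a list. -/
def dCompCoord {s : ℕ} (i : Fin s) (L : List ℕ) (g : (Fin s → ℝ) → ℝ) : (Fin s → ℝ) → ℝ :=
  L.foldr (fun a h => dyadicDiff i (a + 1) h) g

/-- The operator `d_{k_u}` : composition over all coordinates `i` of the dyadic
differences `∂_{i,a_{i,j}+1}`, `1 ≤ j ≤ min(u_i, N_i)`. -/
def dComp {s : ℕ} (u k : Fin s → ℕ) (f : (Fin s → ℝ) → ℝ) : (Fin s → ℝ) → ℝ :=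
  (List.finRange s).foldr (fun i g => dCompCoord i ((bitsDesc (k i)).take (u i)) g) f

/-- The multi-index `ν` increased by one in coordinate `i`. -/
def addE {s : ℕ} (i : Fin s) (ν : Fin s → ℕ) : Fin s → ℕ := Function.update ν i (ν i + 1)

/-- `D` is a family of mixed partial derivatives of `f`, of orders up to `u_i` in
the variable `x_i`, each continuous on the closed cube `[0,1]^s`. -/
def HasMixedDerivs {s : ℕ} (u : Fin s → ℕ) (f : (Fin s → ℝ) → ℝ)
    (D : (Fin s → ℕ) → (Fin s → ℝ) → ℝ) : Prop :=
  D (fun _ => 0) = f ∧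
    (∀ ν : Fin s → ℕ, (∀ j, ν j ≤ u j) → ContinuousOn (D ν) (closedCube s)) ∧
    ∀ (ν : Fin s → ℕ) (i : Fin s), (∀ j, addE i ν j ≤ u j) →
      ∀ x ∈ closedCube s,
        HasDerivWithinAt (fun t => D ν (Function.update x i t)) (D (addE i ν) x)
          (Set.Icc 0 1) (x i)

/-- `∫_{[0,1)^{s-|v|}} F dx_{S∖v}` : the inner integral over the coordinates outside `v`
(as a function of the coordinates in `v`). -/
def projInt {s : ℕ} (v : Finset (Fin s)) (F : (Fin s → ℝ) → ℝ) (x : Fin s → ℝ) : ℝ :=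
  ∫ y in unitCube s, F fun i => if i ∈ v then x i else y i

/-- The mixed norm `‖F^{(·)}‖_p` : the `L^p` norm (over the coordinates in `v`) of the
integral of `F` over the coordinates outside `v`. -/
def mixedNorm {s : ℕ} (p : ℝ≥0∞) (v : Finset (Fin s)) (F : (Fin s → ℝ) → ℝ) : ℝ≥0∞ :=
  eLpNorm (projInt v F) p (volume.restrict (unitCube s))

/-- The `ℓ^q` norm of a finite family in `ℝ≥0∞`, with the usual modification at `q = ∞`. -/
def lqNorm {ι : Type*} [Fintype ι] (q : ℝ≥0∞) (a : ι → ℝ≥0∞) : ℝ≥0∞ :=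
  if q = ∞ then ⨆ i, a i else (∑ i, a i ^ q.toReal) ^ q.toReal⁻¹

/-- The `h`-th point of the digital net generated by the matrices `C i`. -/
def netPoint {s m n : ℕ} (C : Fin s → Matrix (Fin n) (Fin m) (ZMod 2)) (h : Fin (2 ^ m)) :
    Fin s → ℝ :=
  fun i => ∑ j : Fin n,
    (((∑ l : Fin m, (if (h : ℕ).testBit (l : ℕ) then (1 : ZMod 2) else 0) * C i j l).val : ℝ) *
      ((2 : ℝ) ^ ((j : ℕ) + 1))⁻¹)

/-- Membership of `k ∈ ℕ₀^s` in the dual net `P^⊥`. -/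
def inDual {s m n : ℕ} (C : Fin s → Matrix (Fin n) (Fin m) (ZMod 2)) (k : Fin s → ℕ) : Prop :=
  ∀ l : Fin m, ∑ i, ∑ j : Fin n, C i j l * (if (k i).testBit (j : ℕ) then (1 : ZMod 2) else 0) = 0

open Classical in
/-- `∑_{k_v ∈ P_v^⊥} 2^{-μ'_α(k_v)}`, encoded as a sum over all `k ∈ ℕ₀^s`
with support exactly `v` lying in the dual net. -/
def dualSum {s m n : ℕ} (α : ℕ) (C : Fin s → Matrix (Fin n) (Fin m) (ZMod 2))
    (v : Finset (Fin s)) : ℝ≥0∞ :=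
  ∑' k : Fin s → ℕ,
    if (∀ i, i ∈ v ↔ k i ≠ 0) ∧ inDual C k
    then (2 : ℝ≥0∞) ^ (-(muWV (fun _ => α) k : ℝ)) else 0

/-- The `a`-th Rademacher function on the whole real line. -/
def rad (a : ℕ) (x : ℝ) : ℝ := if Even ⌊x * 2 ^ (a + 1)⌋ then 1 else -1

lemma rad_eq_or (a : ℕ) (x : ℝ) : rad a x = 1 ∨ rad a x = -1 := by
  unfold rad; split_ifs <;> simp

lemma abs_rad (a : ℕ) (x : ℝ) : |rad a x| = 1 := by
  rcases rad_eq_or a x with h | h <;> simp [h]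

lemma measurable_rad (a : ℕ) : Measurable (rad a) := by
  have h : Measurable fun x : ℝ => ⌊x * 2 ^ (a + 1)⌋ :=
    Int.measurable_floor.comp (measurable_id.mul_const _)
  have h' : Measurable fun n : ℤ => if Even n then (1 : ℝ) else -1 := measurable_from_top
  exact h'.comp h

lemma neg_one_pow_bdigit {x : ℝ} (hx : 0 ≤ x) (a : ℕ) :
    (-1 : ℝ) ^ bdigit x (a + 1) = rad a x := by
  have h0 : 0 ≤ ⌊x * 2 ^ (a + 1)⌋ := Int.floor_nonneg.2 (by positivity)
  unfold bdigit rad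
  lift ⌊x * 2 ^ (a + 1)⌋ to ℕ using h0 with n
  rw [Int.toNat_natCast, ← neg_one_pow_eq_pow_mod_two]
  split_ifs with h
  · exact Even.neg_one_pow (by exact_mod_cast h)
  · exact Odd.neg_one_pow (by simpa using h)

lemma rad_antiperiodic (a : ℕ) : Function.Antiperiodic (rad a) ((2 : ℝ) ^ (a + 1))⁻¹ := by
  intro x
  have h : ⌊(x + ((2 : ℝ) ^ (a + 1))⁻¹) * 2 ^ (a + 1)⌋ = ⌊x * 2 ^ (a + 1)⌋ + 1 := by
    rw [add_mul, inv_mul_cancel₀ (by positivity), Int.floor_add_one]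
  unfold rad
  rw [h]
  by_cases h' : Even ⌊x * 2 ^ (a + 1)⌋ <;> simp [h']

lemma rad_eq_one {a : ℕ} {x : ℝ} (h0 : 0 ≤ x) (h1 : x < ((2 : ℝ) ^ (a + 1))⁻¹) :
    rad a x = 1 := by
  have h : ⌊x * 2 ^ (a + 1)⌋ = 0 := by
    rw [Int.floor_eq_zero_iff]
    refine ⟨by positivity, ?_⟩
    rwa [← lt_div_iff₀ (by positivity), one_div]
  simp [rad, h]

lemma rad_congr {a j : ℕ} (hj : j < a) {x y : ℝ} (h : ⌊x * 2 ^ a⌋ = ⌊y * 2 ^ a⌋) :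
    rad j x = rad j y := by
  have key : ∀ z : ℝ, ⌊z * 2 ^ (j + 1)⌋ = ⌊z * 2 ^ a⌋ / ((2 ^ (a - (j + 1)) : ℕ) : ℤ) := by
    intro z
    rw [← Int.floor_div_natCast]
    congr 1
    have : (2 : ℝ) ^ a = 2 ^ (j + 1) * 2 ^ (a - (j + 1)) := by
      rw [← pow_add]; congr 1; omega
    rw [this]; push_cast; field_simp
  unfold rad
  rw [key, key, h]

lemma rad_continuousWithinAt (a : ℕ) (x : ℝ) : ContinuousWithinAt (rad a) (Set.Ioi x) x := by
  have h1 : Filter.Tendsto (fun y : ℝ => y * 2 ^ (a + 1)) (nhdsWithin x (Set.Ioi x))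
      (nhdsWithin (x * 2 ^ (a + 1)) (Set.Ici (x * 2 ^ (a + 1)))) := by
    refine tendsto_nhdsWithin_iff.2 ⟨?_, ?_⟩
    · exact ((continuous_id.mul continuous_const).tendsto x).mono_left nhdsWithin_le_nhds
    · filter_upwards [self_mem_nhdsWithin] with y hy
      have : x < y := hy
      simp only [Set.mem_Ici]; gcongr
  have h2 := (tendsto_floor_right_pure_floor (x * 2 ^ (a + 1))).comp h1
  have h3 : ∀ᶠ y in nhdsWithin x (Set.Ioi x), rad a y = rad a x := by
    filter_upwards [Filter.tendsto_pure.1 h2] with y hy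
    simp only [Function.comp] at hy
    unfold rad; rw [hy]
  exact (tendsto_const_nhds (x := rad a x)).congr' (h3.mono fun y hy => hy.symm)

lemma walsh_eq_prod {k N : ℕ} (hk : k < 2 ^ N) {x : ℝ} (hx : 0 ≤ x) :
    walsh k x = ∏ j ∈ range N, if k.testBit j then rad j x else 1 := by
  have h1 : ∀ M, k < 2 ^ M → ∏ j ∈ range M, (if k.testBit j then rad j x else 1) =
      ∏ j ∈ range (max N (max k M)), if k.testBit j then rad j x else 1 := by
    intro M hM
    refine Finset.prod_subset (range_subset_range.2 (by omega)) fun j _ hj => ?_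
    rw [Nat.testBit_lt_two_pow (hM.trans_le (Nat.pow_le_pow_right (by norm_num) (by simpa using hj)))]
    simp
  have h2 : walsh k x = ∏ j ∈ range k, if k.testBit j then rad j x else 1 := by
    unfold walsh
    rw [← Finset.prod_pow_eq_pow_sum]
    refine Finset.prod_congr rfl fun j _ => ?_
    split_ifs
    · exact neg_one_pow_bdigit hx j
    · simp
  rw [h2, h1 k Nat.lt_two_pow_self, h1 N hk]
  congr 2
  omega

lemma walsh_zero (x : ℝ) : walsh 0 x = 1 := by simp [walsh]

lemma abs_walsh (k : ℕ) (x : ℝ) : |walsh k x| = 1 := by simp [walsh, abs_pow]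

lemma measurable_walsh (k : ℕ) : Measurable (walsh k) := by
  have hb : ∀ j, Measurable fun x : ℝ => bdigit x j := by
    intro j
    have h : Measurable fun x : ℝ => ⌊x * 2 ^ j⌋ :=
      Int.measurable_floor.comp (measurable_id.mul_const _)
    have h' : Measurable fun n : ℤ => n.toNat % 2 := measurable_from_top
    exact h'.comp h
  have h1 : Measurable fun x : ℝ =>
      ∑ j ∈ Finset.range k, if k.testBit j then bdigit x (j + 1) else 0 := by
    refine Finset.measurable_sum _ fun j _ => ?_
    split_ifs
    · exact hb _
    · exact measurable_const
  have h2 : Measurable fun n : ℕ => (-1 : ℝ) ^ n := measurable_from_top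
  exact h2.comp h1

lemma walsh_two_pow_add {a k : ℕ} (hk : k < 2 ^ a) {x : ℝ} (hx : 0 ≤ x) :
    walsh (2 ^ a + k) x = walsh k x * rad a x := by
  rw [walsh_eq_prod (N := a + 1) (by rw [pow_succ]; omega) hx, walsh_eq_prod hk hx,
    Finset.prod_range_succ, Nat.testBit_two_pow_add_eq, Nat.testBit_lt_two_pow hk]
  simp only [Bool.not_false, if_true]
  congr 1
  refine Finset.prod_congr rfl fun j hj => ?_
  rw [Nat.testBit_two_pow_add_gt (by simpa using hj)]

lemma walsh_congr {a k : ℕ} (hk : k < 2 ^ a) {x y : ℝ} (hx : 0 ≤ x) (hy : 0 ≤ y)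
    (h : ⌊x * 2 ^ a⌋ = ⌊y * 2 ^ a⌋) : walsh k x = walsh k y := by
  rw [walsh_eq_prod hk hx, walsh_eq_prod hk hy]
  refine Finset.prod_congr rfl fun j hj => ?_
  rw [rad_congr (by simpa using hj) h]

/-- `U` is a nonnegative continuous function of period `2⁻ᵇ` with mean `c` and supremum at
most `2c`. -/
structure IsProfile (b : ℕ) (c : ℝ) (U : ℝ → ℝ) : Prop where
  continuous : Continuous U
  periodic : Function.Periodic U ((2 : ℝ) ^ b)⁻¹
  nonneg : ∀ x, 0 ≤ U x
  le : ∀ x, U x ≤ 2 * c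
  integral : ∫ x in (0 : ℝ)..1, U x = c

lemma isProfile_one (b : ℕ) : IsProfile b 1 fun _ => 1 where
  continuous := continuous_const
  periodic := fun _ => rfl
  nonneg := fun _ => zero_le_one
  le := fun _ => by norm_num
  integral := by simp

lemma integral_zero_one_of_periodic {b : ℕ} {U : ℝ → ℝ} (hU : Continuous U)
    (hp : Function.Periodic U ((2 : ℝ) ^ b)⁻¹) :
    ∫ x in (0 : ℝ)..1, U x = 2 ^ b * ∫ x in (0 : ℝ)..((2 : ℝ) ^ b)⁻¹, U x := by
  have h := hp.intervalIntegral_add_zsmul_eq ((2 ^ b : ℕ) : ℤ) 0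
    fun _ _ => hU.intervalIntegrable _ _
  simpa using h

lemma periodic_of_le {a b : ℕ} (hab : a ≤ b) {U : ℝ → ℝ}
    (hp : Function.Periodic U ((2 : ℝ) ^ b)⁻¹) : Function.Periodic U ((2 : ℝ) ^ a)⁻¹ := by
  have h := hp.nat_mul (2 ^ (b - a))
  have e : ((2 ^ (b - a) : ℕ) : ℝ) * ((2 : ℝ) ^ b)⁻¹ = ((2 : ℝ) ^ a)⁻¹ := by
    have : (2 : ℝ) ^ b = 2 ^ a * 2 ^ (b - a) := by rw [← pow_add]; congr 1; omega
    rw [this]; push_cast; field_simp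
  rwa [e] at h

/-- The primitive of the product of a Rademacher function and `U`. -/
def radPrimitive (a : ℕ) (U : ℝ → ℝ) (x : ℝ) : ℝ := ∫ t in (0 : ℝ)..x, rad a t * U t

section RadPrimitive

variable {a : ℕ} {U : ℝ → ℝ}

lemma intervalIntegrable_rad_mul (hU : Continuous U) (u v : ℝ) :
    IntervalIntegrable (fun t => rad a t * U t) volume u v := by
  have h := hU.intervalIntegrable (μ := volume) u v
  rw [intervalIntegrable_iff] at h ⊢
  exact h.bdd_mul (c := 1) (measurable_rad a).aestronglyMeasurable
    (Filter.Eventually.of_forall fun t => by rw [Real.norm_eq_abs, abs_rad])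

lemma continuous_radPrimitive (hU : Continuous U) : Continuous (radPrimitive a U) :=
  intervalIntegral.continuous_primitive (fun u v => intervalIntegrable_rad_mul hU u v) 0

lemma radPrimitive_zero : radPrimitive a U 0 = 0 := by simp [radPrimitive]

lemma hasDerivWithinAt_radPrimitive (hU : Continuous U) (x : ℝ) :
    HasDerivWithinAt (radPrimitive a U) (rad a x * U x) (Set.Ioi x) x := by
  have hm : StronglyMeasurableAtFilter (fun t => rad a t * U t) (nhdsWithin x (Set.Ioi x))
      volume :=
    ((measurable_rad a).mul hU.measurable).stronglyMeasurable.stronglyMeasurableAtFilter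
  have hc : ContinuousWithinAt (fun t => rad a t * U t) (Set.Ioi x) x :=
    (rad_continuousWithinAt a x).mul hU.continuousWithinAt
  exact (intervalIntegral.integral_hasDerivWithinAt_right (s := Set.Ici x) (t := Set.Ioi x)
    (intervalIntegrable_rad_mul hU 0 x) hm hc).mono Set.Ioi_subset_Ici_self

lemma radPrimitive_add (hU : Continuous U)
    (hp : Function.Periodic U ((2 : ℝ) ^ (a + 1))⁻¹) (x : ℝ) :
    radPrimitive a U (x + ((2 : ℝ) ^ (a + 1))⁻¹) =
      radPrimitive a U ((2 : ℝ) ^ (a + 1))⁻¹ - radPrimitive a U x := by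
  set h := ((2 : ℝ) ^ (a + 1))⁻¹
  have e : ∫ t in (0 + h)..(x + h), rad a t * U t = - radPrimitive a U x := by
    rw [← intervalIntegral.integral_comp_add_right fun t => rad a t * U t, radPrimitive,
      ← intervalIntegral.integral_neg]
    refine intervalIntegral.integral_congr fun t _ => ?_
    have r : rad a (t + h) = -rad a t := rad_antiperiodic a t
    simp only [r, hp t, neg_mul]
  have s := intervalIntegral.integral_add_adjacent_intervals
    (intervalIntegrable_rad_mul (a := a) hU 0 (0 + h))
    (intervalIntegrable_rad_mul (a := a) hU (0 + h) (x + h))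
  rw [e] at s
  simp only [zero_add] at s
  simp only [radPrimitive] at s ⊢
  linarith

lemma radPrimitive_eq {x : ℝ} (h0 : 0 ≤ x) (h1 : x ≤ ((2 : ℝ) ^ (a + 1))⁻¹) :
    radPrimitive a U x = ∫ t in (0 : ℝ)..x, U t := by
  refine intervalIntegral.integral_congr_ae ?_
  have : ∀ᵐ t : ℝ, t ≠ x := by simp [ae_iff]
  filter_upwards [this] with t ht hmem
  rw [Set.uIoc_of_le h0] at hmem
  rw [rad_eq_one hmem.1.le ((lt_of_le_of_ne hmem.2 ht).trans_le h1), one_mul]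

lemma inv_two_pow_eq (a : ℕ) :
    ((2 : ℝ) ^ a)⁻¹ = ((2 : ℝ) ^ (a + 1))⁻¹ + ((2 : ℝ) ^ (a + 1))⁻¹ := by
  rw [pow_succ]; field_simp; norm_num

lemma radPrimitive_periodic (hU : Continuous U)
    (hp : Function.Periodic U ((2 : ℝ) ^ (a + 1))⁻¹) :
    Function.Periodic (radPrimitive a U) ((2 : ℝ) ^ a)⁻¹ := by
  intro x
  rw [inv_two_pow_eq, ← add_assoc, radPrimitive_add hU hp, radPrimitive_add hU hp]
  ring

lemma radPrimitive_natCast_div (hU : Continuous U)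
    (hp : Function.Periodic U ((2 : ℝ) ^ (a + 1))⁻¹) (n : ℕ) :
    radPrimitive a U (n * ((2 : ℝ) ^ a)⁻¹) = 0 := by
  have h := (radPrimitive_periodic hU hp).nat_mul n 0
  rwa [zero_add, radPrimitive_zero] at h

end RadPrimitive

lemma IsProfile.radPrimitive {a b : ℕ} {c : ℝ} {U : ℝ → ℝ} (hU : IsProfile b c U)
    (hab : a < b) : IsProfile a (c * ((2 : ℝ) ^ (a + 2))⁻¹) (radPrimitive a U) := by
  have hp := periodic_of_le (show a + 1 ≤ b from hab) hU.periodic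
  have hc := continuous_radPrimitive (a := a) hU.continuous
  have hpp := radPrimitive_periodic hU.continuous hp
  set h := ((2 : ℝ) ^ (a + 1))⁻¹ with hh
  have hpos : 0 < h := by positivity
  have hVh : _root_.radPrimitive a U h = c * h := by
    rw [radPrimitive_eq hpos.le le_rfl]
    have := integral_zero_one_of_periodic hU.continuous hp
    rw [hU.integral] at this
    rw [this, hh]; field_simp
  have h2 : 2 * (c * ((2 : ℝ) ^ (a + 2))⁻¹) = c * h := by
    rw [hh, pow_succ _ (a + 1)]; field_simp
  have bound : ∀ x ∈ Set.Icc 0 h,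
      0 ≤ _root_.radPrimitive a U x ∧ _root_.radPrimitive a U x ≤ c * h := by
    intro x hx
    rw [← hVh, radPrimitive_eq hx.1 hx.2, radPrimitive_eq hpos.le le_rfl]
    refine ⟨intervalIntegral.integral_nonneg hx.1 fun t _ => hU.nonneg t, ?_⟩
    exact intervalIntegral.integral_mono_interval le_rfl hx.1 hx.2
      (Filter.Eventually.of_forall hU.nonneg) (hU.continuous.intervalIntegrable _ _)
  have bound' : ∀ x, 0 ≤ _root_.radPrimitive a U x ∧ _root_.radPrimitive a U x ≤ c * h := by
    intro x
    obtain ⟨y, hy, hxy⟩ := hpp.exists_mem_Ico₀ (by positivity) x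
    rw [hxy]
    rw [inv_two_pow_eq, ← hh] at hy
    rcases le_total y h with hle | hle
    · exact bound y ⟨hy.1, hle⟩
    · have e := radPrimitive_add hU.continuous hp (y - h)
      rw [← hh, sub_add_cancel, hVh] at e
      have := bound (y - h) ⟨by linarith, by linarith [hy.2]⟩
      rw [e]
      constructor <;> linarith [this.1, this.2]
  refine ⟨hc, hpp, fun x => (bound' x).1, fun x => h2 ▸ (bound' x).2, ?_⟩
  rw [integral_zero_one_of_periodic hc hpp, inv_two_pow_eq, ← hh,
    ← intervalIntegral.integral_add_adjacent_intervals (hc.intervalIntegrable 0 h)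
      (hc.intervalIntegrable h (h + h))]
  have e : ∫ t in h..(h + h), _root_.radPrimitive a U t =
      ∫ t in (0 : ℝ)..h, (c * h - _root_.radPrimitive a U t) := by
    have := intervalIntegral.integral_comp_add_right (a := 0) (b := h) (_root_.radPrimitive a U) h
    rw [zero_add] at this
    rw [← this]
    refine intervalIntegral.integral_congr fun t _ => ?_
    have r := radPrimitive_add hU.continuous hp t
    rwa [← hh, hVh] at r
  rw [e, intervalIntegral.integral_sub (by simp) (hc.intervalIntegrable 0 h)]
  simp only [add_sub_cancel, intervalIntegral.integral_const, smul_eq_mul, sub_zero]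
  rw [hh, pow_succ _ (a + 1), pow_succ]
  field_simp

lemma bitsDesc_eq {k N : ℕ} (hk : k < 2 ^ N) :
    bitsDesc k = ((List.range N).filter fun j => k.testBit j).reverse := by
  have h : ∀ M, k < 2 ^ M → ∀ d,
      ((List.range (M + d)).filter fun j => k.testBit j) =
        (List.range M).filter fun j => k.testBit j := by
    intro M hM d
    induction d with
    | zero => rfl
    | succ d ih =>
      have ht : k.testBit (M + d) = false :=
        Nat.testBit_lt_two_pow (hM.trans_le (Nat.pow_le_pow_right (by norm_num) (by omega)))
      rw [← add_assoc, List.range_succ, List.filter_append, ih]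
      simp [ht]
  unfold bitsDesc
  rw [← h k Nat.lt_two_pow_self N, ← h N hk k, add_comm]

lemma bitsDesc_two_pow_add {a k : ℕ} (hk : k < 2 ^ a) :
    bitsDesc (2 ^ a + k) = a :: bitsDesc k := by
  rw [bitsDesc_eq (N := a + 1) (by rw [pow_succ]; omega), bitsDesc_eq hk, List.range_succ,
    List.filter_append, List.reverse_append]
  have h1 : (2 ^ a + k).testBit a = true := by
    rw [Nat.testBit_two_pow_add_eq, Nat.testBit_lt_two_pow hk]; rfl
  have h2 : ((List.range a).filter fun j => (2 ^ a + k).testBit j) =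
      (List.range a).filter fun j => k.testBit j := by
    refine List.filter_congr fun j hj => ?_
    rw [Nat.testBit_two_pow_add_gt (by simpa using hj)]
  rw [h2]
  simp [h1]

lemma numBits_zero : numBits 0 = 0 := rfl

lemma numBits_two_pow_add {a k : ℕ} (hk : k < 2 ^ a) :
    numBits (2 ^ a + k) = numBits k + 1 := by
  simp [numBits, bitsDesc_two_pow_add hk]

lemma muW_succ_two_pow_add {a k : ℕ} (hk : k < 2 ^ a) (u : ℕ) :
    muW (u + 1) (2 ^ a + k) = (a + 2) + muW u k := by
  simp [muW, bitsDesc_two_pow_add hk]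

lemma muW_zero_right (u : ℕ) : muW u 0 = 0 := by simp [muW, bitsDesc]

lemma muW_zero_left (k : ℕ) : muW 0 k = 0 := by simp [muW]

lemma exists_eq_two_pow_add {k : ℕ} (hk : k ≠ 0) : ∃ a k', k' < 2 ^ a ∧ k = 2 ^ a + k' := by
  refine ⟨k.log2, k - 2 ^ k.log2, ?_, ?_⟩
  · have := Nat.lt_log2_self (n := k)
    rw [pow_succ] at this
    omega
  · have := Nat.log2_self_le hk
    omega

lemma floor_mul_two_pow_eq {a j : ℕ} {x : ℝ} (h0 : j * ((2 : ℝ) ^ a)⁻¹ ≤ x)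
    (h1 : x < (j + 1 : ℕ) * ((2 : ℝ) ^ a)⁻¹) : ⌊x * 2 ^ a⌋ = j := by
  rw [Int.floor_eq_iff]
  rw [← div_eq_mul_inv] at h0 h1
  rw [div_le_iff₀ (by positivity)] at h0
  rw [lt_div_iff₀ (by positivity)] at h1
  push_cast at h1 ⊢
  exact ⟨h0, h1⟩

/-- Integration by parts against a Walsh function times a profile of finer period. -/
lemma integral_mul_walsh_mul_profile {a b k : ℕ} {c : ℝ} {U g g' : ℝ → ℝ}
    (hU : IsProfile b c U) (hab : a < b) (hk : k < 2 ^ a)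
    (hg : ContinuousOn g (Set.Icc 0 1)) (hg' : ContinuousOn g' (Set.Icc 0 1))
    (hd : ∀ x ∈ Set.Icc (0 : ℝ) 1, HasDerivWithinAt g (g' x) (Set.Icc 0 1) x) :
    ∫ x in (0 : ℝ)..1, g x * (walsh (2 ^ a + k) x * U x) =
      -∫ x in (0 : ℝ)..1, g' x * (walsh k x * radPrimitive a U x) := by
  have hp := periodic_of_le (show a + 1 ≤ b from hab) hU.periodic
  have hV := continuous_radPrimitive (a := a) hU.continuous
  have hint : ∀ (φ W : ℝ → ℝ) (j : ℕ), ContinuousOn φ (Set.Icc 0 1) → Continuous W →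
      ∀ u ∈ Set.Icc (0 : ℝ) 1, ∀ v ∈ Set.Icc (0 : ℝ) 1,
      IntervalIntegrable (fun x => φ x * (walsh j x * W x)) volume u v := by
    intro φ W j hφ hW u hu v hv
    have h1 : IntervalIntegrable (fun x => φ x * W x) volume u v :=
      ((hφ.mul hW.continuousOn).mono (Set.uIcc_subset_Icc hu hv)).intervalIntegrable
    rw [intervalIntegrable_iff] at h1 ⊢
    have := h1.bdd_mul (c := 1) (measurable_walsh j).aestronglyMeasurable
      (Filter.Eventually.of_forall fun t => by rw [Real.norm_eq_abs, abs_walsh])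
    refine this.congr (Filter.Eventually.of_forall fun t => ?_)
    simp only []; ring
  set h := ((2 : ℝ) ^ a)⁻¹ with hh
  have hpos : 0 < h := by positivity
  have hmem : ∀ j : ℕ, j ≤ 2 ^ a → (j : ℝ) * h ∈ Set.Icc (0 : ℝ) 1 := by
    intro j hj
    refine ⟨by positivity, ?_⟩
    rw [hh, ← div_eq_mul_inv, div_le_one (by positivity)]
    exact_mod_cast hj
  have hend : ((2 ^ a : ℕ) : ℝ) * h = 1 := by rw [hh]; push_cast; field_simp
  have split : ∀ (φ W : ℝ → ℝ) (j : ℕ), ContinuousOn φ (Set.Icc 0 1) → Continuous W →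
      ∫ x in (0 : ℝ)..1, φ x * (walsh j x * W x) =
        ∑ i ∈ range (2 ^ a),
          ∫ x in ((i : ℕ) * h)..((i + 1 : ℕ) * h), φ x * (walsh j x * W x) := by
    intro φ W j hφ hW
    rw [intervalIntegral.sum_integral_adjacent_intervals (a := fun i : ℕ => (i : ℝ) * h), hend]
    · simp
    · intro i hi
      exact hint φ W j hφ hW _ (hmem _ hi.le) _ (hmem _ hi)
  rw [split g U _ hg hU.continuous, split g' _ _ hg' hV, ← Finset.sum_neg_distrib]
  refine Finset.sum_congr rfl fun i hi => ?_
  have hi : i < 2 ^ a := by simpa using hi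
  have hle : (i : ℝ) * h ≤ (i + 1 : ℕ) * h := by push_cast; nlinarith
  have hsub : Set.Icc ((i : ℝ) * h) ((i + 1 : ℕ) * h) ⊆ Set.Icc 0 1 :=
    Set.Icc_subset_Icc (hmem i hi.le).1 (hmem (i + 1) hi).2
  have hcell : ∀ x ∈ Set.Ico ((i : ℝ) * h) ((i + 1 : ℕ) * h),
      walsh k x = walsh k (i * h) := by
    intro x hx
    have hlt : (i : ℝ) * h < (i + 1 : ℕ) * h := by push_cast; nlinarith
    refine walsh_congr hk ((hmem i hi.le).1.trans hx.1) (hmem i hi.le).1 ?_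
    rw [floor_mul_two_pow_eq hx.1 hx.2, floor_mul_two_pow_eq le_rfl hlt]
  have cell : ∀ F G : ℝ → ℝ, (∀ x ∈ Set.Ico ((i : ℝ) * h) ((i + 1 : ℕ) * h), F x = G x) →
      ∫ x in ((i : ℕ) * h)..((i + 1 : ℕ) * h), F x =
        ∫ x in ((i : ℕ) * h)..((i + 1 : ℕ) * h), G x := by
    intro F G hFG
    refine intervalIntegral.integral_congr_ae ?_
    have : ∀ᵐ t : ℝ, t ≠ (i + 1 : ℕ) * h := by simp [ae_iff]
    filter_upwards [this] with t ht hmem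
    rw [Set.uIoc_of_le hle] at hmem
    exact hFG t ⟨hmem.1.le, lt_of_le_of_ne hmem.2 ht⟩
  have e1 := cell (fun x => g x * (walsh (2 ^ a + k) x * U x))
    (fun x => walsh k (i * h) * (g x * (rad a x * U x))) fun x hx => by
      rw [walsh_two_pow_add hk ((hmem i hi.le).1.trans hx.1), hcell x hx]; ring
  have e2 := cell (fun x => g' x * (walsh k x * radPrimitive a U x))
    (fun x => walsh k (i * h) * (g' x * radPrimitive a U x)) fun x hx => by
      rw [hcell x hx]; ring
  rw [e1, e2, intervalIntegral.integral_const_mul, intervalIntegral.integral_const_mul]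
  have parts := intervalIntegral.integral_mul_deriv_eq_deriv_mul_of_hasDeriv_right
    (a := (i : ℝ) * h) (b := (i + 1 : ℕ) * h) (u := g) (u' := g') (v := radPrimitive a U)
    (v' := fun x => rad a x * U x)
    (by rw [Set.uIcc_of_le hle]; exact hg.mono hsub) hV.continuousOn
    (by
      intro x hx
      rw [min_eq_left hle, max_eq_right hle] at hx
      have hx' : x ∈ Set.Ioo (0 : ℝ) 1 :=
        ⟨(hmem i hi.le).1.trans_lt hx.1, hx.2.trans_le (hmem (i + 1) hi).2⟩
      exact ((hd x (Set.Ioo_subset_Icc_self hx')).hasDerivAt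
        (Icc_mem_nhds hx'.1 hx'.2)).hasDerivWithinAt)
    (fun x _ => hasDerivWithinAt_radPrimitive hU.continuous x)
    (by
      refine ContinuousOn.intervalIntegrable ?_
      rw [Set.uIcc_of_le hle]; exact hg'.mono hsub)
    (intervalIntegrable_rad_mul hU.continuous _ _)
  rw [parts, hh, radPrimitive_natCast_div hU.continuous hp,
    radPrimitive_natCast_div hU.continuous hp]
  ring

/-- `w` represents the functional `g ↦ ∫ g φ` on `Cʳ` functions through the `r`-th
derivative, with `|w| ≤ B` and `∫ |w| ≤ c`. -/
structure IsDerivKernel (φ : ℝ → ℝ) (r : ℕ) (B c : ℝ) (w : ℝ → ℝ) : Prop where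
  measurable : Measurable w
  abs_le : ∀ x, |w x| ≤ B
  integral_abs_le : ∫ x in (0 : ℝ)..1, |w x| ≤ c
  integral_eq : ∀ G : ℕ → ℝ → ℝ, (∀ j ≤ r, ContinuousOn (G j) (Set.Icc 0 1)) →
    (∀ j < r, ∀ x ∈ Set.Icc (0 : ℝ) 1,
      HasDerivWithinAt (G j) (G (j + 1) x) (Set.Icc 0 1) x) →
    ∫ x in (0 : ℝ)..1, G 0 x * φ x = ∫ x in (0 : ℝ)..1, G r x * w x

lemma isDerivKernel_self {b : ℕ} {c : ℝ} {U : ℝ → ℝ} (hU : IsProfile b c U) (k : ℕ) :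
    IsDerivKernel (fun x => walsh k x * U x) 0 (2 * c) c fun x => walsh k x * U x where
  measurable := (measurable_walsh k).mul hU.continuous.measurable
  abs_le x := by
    rw [abs_mul, abs_walsh, one_mul, abs_of_nonneg (hU.nonneg x)]
    exact hU.le x
  integral_abs_le := by
    simp only [abs_mul, abs_walsh, one_mul, abs_of_nonneg (hU.nonneg _), hU.integral, le_refl]
  integral_eq _ _ _ := rfl

lemma exists_isDerivKernel_profile (u : ℕ) : ∀ {b k : ℕ} {c : ℝ} {U : ℝ → ℝ},
    IsProfile b c U → k < 2 ^ b → ∃ w, IsDerivKernel (fun x => walsh k x * U x)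
      (min u (numBits k)) (2 * (c * ((2 : ℝ) ^ muW u k)⁻¹)) (c * ((2 : ℝ) ^ muW u k)⁻¹) w := by
  induction u with
  | zero =>
    intro b k c U hU _
    refine ⟨fun x => walsh k x * U x, ?_⟩
    rw [muW_zero_left, Nat.zero_min, pow_zero, inv_one, mul_one]
    exact isDerivKernel_self hU k
  | succ u ih =>
    intro b k c U hU hk
    rcases eq_or_ne k 0 with rfl | hk0
    · refine ⟨fun x => walsh 0 x * U x, ?_⟩
      rw [muW_zero_right, numBits_zero, Nat.min_zero, pow_zero, inv_one, mul_one]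
      exact isDerivKernel_self hU 0
    · obtain ⟨a, k', hk', rfl⟩ := exists_eq_two_pow_add hk0
      have hab : a < b := (Nat.pow_lt_pow_iff_right one_lt_two).1 (by omega)
      obtain ⟨w, hw⟩ := ih (hU.radPrimitive hab) hk'
      have hc : c * ((2 : ℝ) ^ (a + 2))⁻¹ * ((2 : ℝ) ^ muW u k')⁻¹ =
          c * ((2 : ℝ) ^ muW (u + 1) (2 ^ a + k'))⁻¹ := by
        rw [muW_succ_two_pow_add hk', pow_add _ (a + 2), mul_inv, mul_assoc]
      rw [hc] at hw
      refine ⟨fun x => -w x, hw.measurable.neg, fun x => by rw [abs_neg]; exact hw.abs_le x,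
        by simpa only [abs_neg] using hw.integral_abs_le, fun G hG hG' => ?_⟩
      rw [numBits_two_pow_add hk', Nat.succ_min_succ] at hG hG' ⊢
      rw [integral_mul_walsh_mul_profile hU hab hk' (hG 0 (by omega)) (hG 1 (by omega))
        (hG' 0 (by omega)), hw.integral_eq (fun j => G (j + 1)) (fun j hj => hG _ (by omega))
        (fun j hj => hG' _ (by omega))]
      simp

lemma exists_isDerivKernel_walsh (u : ℕ) {k : ℕ} :
    ∃ w, IsDerivKernel (walsh k) (min u (numBits k))
      (if k = 0 then 1 else 2 * ((2 : ℝ) ^ muW u k)⁻¹) ((2 : ℝ) ^ muW u k)⁻¹ w ∧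
        (k = 0 → ∀ x, w x = 1) := by
  rcases eq_or_ne k 0 with rfl | hk
  · refine ⟨fun _ => 1, ⟨measurable_const, by simp, by simp [muW_zero_right], ?_⟩, by simp⟩
    intro G _ _
    simp [walsh_zero, numBits_zero]
  · obtain ⟨w, hw⟩ := exists_isDerivKernel_profile u (isProfile_one k) (k := k)
      Nat.lt_two_pow_self
    refine ⟨w, ?_, fun h => absurd h hk⟩
    rw [if_neg hk]
    simpa only [one_mul, mul_one] using hw

lemma integral_walsh {k : ℕ} (hk : k ≠ 0) : ∫ x in (0 : ℝ)..1, walsh k x = 0 := by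
  obtain ⟨a, k', hk', rfl⟩ := exists_eq_two_pow_add hk
  have h := integral_mul_walsh_mul_profile (g := fun _ => 1) (g' := fun _ => 0)
    (isProfile_one (a + 1)) (Nat.lt_succ_self a) hk' continuousOn_const continuousOn_const
    (fun x _ => hasDerivWithinAt_const _ _ _)
  simpa using h

lemma sum_prod_testBit (m : ℕ) (e : ℕ → ℝ) :
    ∑ h ∈ range (2 ^ m), ∏ l ∈ range m, (if h.testBit l then e l else 1) =
      ∏ l ∈ range m, (1 + e l) := by
  induction m with
  | zero => simp
  | succ m ih =>
    rw [pow_succ, mul_two, Finset.sum_range_add, Finset.prod_range_succ, mul_add, mul_one, ← ih,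
      Finset.sum_mul]
    congr 1
    · refine Finset.sum_congr rfl fun h hh => ?_
      rw [Finset.prod_range_succ, Nat.testBit_lt_two_pow (by simpa using hh)]
      simp
    · refine Finset.sum_congr rfl fun h hh => ?_
      rw [Finset.prod_range_succ, Nat.testBit_two_pow_add_eq,
        Nat.testBit_lt_two_pow (by simpa using hh)]
      simp only [Bool.not_false, if_true]
      congr 1
      refine Finset.prod_congr rfl fun l hl => ?_
      rw [Nat.testBit_two_pow_add_gt (by simpa using hl)]

lemma sum_prod_testBit_fin (m : ℕ) (e : Fin m → ℝ) :
    ∑ h : Fin (2 ^ m), ∏ l : Fin m, (if (h : ℕ).testBit l then e l else 1) =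
      ∏ l, (1 + e l) := by
  have h := sum_prod_testBit m fun l => if hl : l < m then e ⟨l, hl⟩ else 1
  rw [Finset.sum_range] at h
  simpa [Finset.prod_range] using h

/-- The `2ᴺ`-th Walsh–Dirichlet kernel. -/
def dirichlet (N : ℕ) (x y : ℝ) : ℝ := ∏ j ∈ range N, (1 + rad j x * rad j y)

lemma sum_walsh_mul_walsh (N : ℕ) {x y : ℝ} (hx : 0 ≤ x) (hy : 0 ≤ y) :
    ∑ k ∈ range (2 ^ N), walsh k x * walsh k y = dirichlet N x y := by
  rw [dirichlet, ← sum_prod_testBit]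
  refine Finset.sum_congr rfl fun k hk => ?_
  have hk : k < 2 ^ N := by simpa using hk
  rw [walsh_eq_prod hk hx, walsh_eq_prod hk hy, ← Finset.prod_mul_distrib]
  refine Finset.prod_congr rfl fun j _ => ?_
  split_ifs <;> simp

lemma dirichlet_nonneg (N : ℕ) (x y : ℝ) : 0 ≤ dirichlet N x y := by
  refine Finset.prod_nonneg fun j _ => ?_
  rcases rad_eq_or j x with h | h <;> rcases rad_eq_or j y with h' | h' <;> norm_num [h, h']

lemma dirichlet_le (N : ℕ) (x y : ℝ) : dirichlet N x y ≤ 2 ^ N := by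
  have : dirichlet N x y ≤ ∏ _j ∈ range N, (2 : ℝ) := by
    refine Finset.prod_le_prod (fun j _ => ?_) fun j _ => ?_ <;>
    rcases rad_eq_or j x with h | h <;> rcases rad_eq_or j y with h' | h' <;> norm_num [h, h']
  simpa using this

lemma measurable_dirichlet (N : ℕ) (x : ℝ) : Measurable (dirichlet N x) :=
  Finset.measurable_fun_prod _ fun j _ => ((measurable_rad j).const_mul _).const_add _

lemma intervalIntegrable_walsh (k : ℕ) (u v : ℝ) : IntervalIntegrable (walsh k) volume u v := by
  have h : IntervalIntegrable (fun _ => (1 : ℝ)) volume u v := by simp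
  refine h.mono_fun (measurable_walsh k).aestronglyMeasurable
    (Filter.Eventually.of_forall fun x => ?_)
  simp [abs_walsh]

lemma integral_dirichlet (N : ℕ) {x : ℝ} (hx : 0 ≤ x) :
    ∫ y in (0 : ℝ)..1, dirichlet N x y = 1 := by
  have h : ∫ y in (0 : ℝ)..1, dirichlet N x y =
      ∫ y in (0 : ℝ)..1, ∑ k ∈ range (2 ^ N), walsh k x * walsh k y := by
    refine intervalIntegral.integral_congr fun y hy => ?_
    rw [Set.uIcc_of_le zero_le_one] at hy
    exact (sum_walsh_mul_walsh N hx hy.1).symm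
  rw [h, intervalIntegral.integral_finsetSum
    fun k _ => (intervalIntegrable_walsh k 0 1).const_mul _]
  rw [Finset.sum_eq_single_of_mem 0 (by simp)]
  · simp [walsh_zero]
  · intro k _ hk
    rw [intervalIntegral.integral_const_mul, integral_walsh hk, mul_zero]

lemma floor_eq_of_dirichlet_ne_zero {N : ℕ} {x y : ℝ} (hx : x ∈ Set.Ico (0 : ℝ) 1)
    (hy : y ∈ Set.Ico (0 : ℝ) 1) (h : dirichlet N x y ≠ 0) : ⌊x * 2 ^ N⌋ = ⌊y * 2 ^ N⌋ := by
  induction N with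
  | zero =>
    rw [pow_zero, mul_one, mul_one, Int.floor_eq_zero_iff.2 hx, Int.floor_eq_zero_iff.2 hy]
  | succ N ih =>
    rw [dirichlet, Finset.prod_range_succ] at h
    have ih := ih (left_ne_zero_of_mul h)
    have key : ∀ z : ℝ, ⌊z * 2 ^ N⌋ = ⌊z * 2 ^ (N + 1)⌋ / 2 := by
      intro z
      have e : z * 2 ^ N = z * 2 ^ (N + 1) / (2 : ℕ) := by rw [pow_succ]; push_cast; ring
      rw [e, Int.floor_div_natCast]
      rfl
    rw [key, key] at ih
    have h2 := right_ne_zero_of_mul h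
    unfold rad at h2
    by_cases p : Even ⌊x * 2 ^ (N + 1)⌋ <;> by_cases q : Even ⌊y * 2 ^ (N + 1)⌋
    · rw [Int.even_iff] at p q; omega
    · simp [p, q] at h2
    · simp [p, q] at h2
    · rw [Int.even_iff] at p q; omega

lemma abs_sub_lt_of_dirichlet_ne_zero {N : ℕ} {x y : ℝ} (hx : x ∈ Set.Ico (0 : ℝ) 1)
    (hy : y ∈ Set.Ico (0 : ℝ) 1) (h : dirichlet N x y ≠ 0) : |y - x| < ((2 : ℝ) ^ N)⁻¹ := by
  have h1 := Int.abs_sub_lt_one_of_floor_eq_floor (floor_eq_of_dirichlet_ne_zero hx hy h).symm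
  rw [← sub_mul, abs_mul, abs_of_pos (by positivity : (0 : ℝ) < 2 ^ N)] at h1
  rwa [← one_div, lt_div_iff₀ (by positivity)]

section BinaryExpansion

lemma binary_mem_Ico {y : ℕ → ℕ} (hy : ∀ j, y j ≤ 1) (n : ℕ) :
    ∑ i ∈ range n, (y i : ℝ) * ((2 : ℝ) ^ (i + 1))⁻¹ ∈ Set.Ico (0 : ℝ) 1 := by
  refine ⟨Finset.sum_nonneg fun i _ => by positivity, ?_⟩
  have h : ∑ i ∈ range n, (y i : ℝ) * ((2 : ℝ) ^ (i + 1))⁻¹ ≤ 1 - ((2 : ℝ) ^ n)⁻¹ := by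
    induction n with
    | zero => simp
    | succ n ih =>
      rw [Finset.sum_range_succ]
      have h1 : (y n : ℝ) ≤ 1 := by exact_mod_cast hy n
      have h2 : (y n : ℝ) * ((2 : ℝ) ^ (n + 1))⁻¹ ≤ 1 * ((2 : ℝ) ^ (n + 1))⁻¹ := by gcongr
      have h3 := inv_two_pow_eq n
      linarith
  have : (0 : ℝ) < ((2 : ℝ) ^ n)⁻¹ := by positivity
  linarith

lemma rad_binary (n j : ℕ) {y : ℕ → ℕ} (hy : ∀ j, y j ≤ 1) :
    rad j (∑ i ∈ range n, (y i : ℝ) * ((2 : ℝ) ^ (i + 1))⁻¹) =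
      if j < n then (-1) ^ y j else 1 := by
  induction j generalizing n y with
  | zero =>
    cases n with
    | zero => simp [rad]
    | succ n =>
      have hm := binary_mem_Ico (fun j => hy (j + 1)) n
      have e : (∑ i ∈ range (n + 1), (y i : ℝ) * ((2 : ℝ) ^ (i + 1))⁻¹) * 2 ^ (0 + 1) =
          (∑ i ∈ range n, (y (i + 1) : ℝ) * ((2 : ℝ) ^ (i + 1))⁻¹) + ((y 0 : ℤ) : ℝ) := by
        rw [Finset.sum_range_succ', add_mul, Finset.sum_mul]
        congr 1
        · refine Finset.sum_congr rfl fun i _ => ?_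
          rw [pow_succ _ (i + 1)]; field_simp; ring
        · simp
      unfold rad
      rw [e, Int.floor_add_intCast, Int.floor_eq_zero_iff.2 hm, zero_add]
      have := hy 0
      rcases Nat.le_one_iff_eq_zero_or_eq_one.1 this with h | h <;> simp [h]
  | succ j ih =>
    cases n with
    | zero => simp [rad]
    | succ n =>
      have e : rad (j + 1) (∑ i ∈ range (n + 1), (y i : ℝ) * ((2 : ℝ) ^ (i + 1))⁻¹) =
          rad j (∑ i ∈ range n, (y (i + 1) : ℝ) * ((2 : ℝ) ^ (i + 1))⁻¹) := by
        have e1 : (∑ i ∈ range (n + 1), (y i : ℝ) * ((2 : ℝ) ^ (i + 1))⁻¹) * 2 ^ (j + 1 + 1) =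
            (∑ i ∈ range n, (y (i + 1) : ℝ) * ((2 : ℝ) ^ (i + 1))⁻¹) * 2 ^ (j + 1) +
              ((y 0 * 2 ^ (j + 1) : ℤ) : ℝ) := by
          rw [Finset.sum_range_succ', add_mul, Finset.sum_mul, Finset.sum_mul]
          congr 1
          · refine Finset.sum_congr rfl fun i _ => ?_
            rw [pow_succ _ (i + 1), pow_succ _ (j + 1)]; field_simp
          · rw [pow_succ _ (j + 1)]; push_cast; field_simp
        unfold rad
        rw [e1, Int.floor_add_intCast]
        simp [Int.even_add, Int.even_pow]
      rw [e, ih n fun j => hy (j + 1)]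
      simp

end BinaryExpansion

/-- The nontrivial additive character of `𝔽₂`. -/
def signChar : AddChar (ZMod 2) ℝ where
  toFun z := (-1) ^ z.val
  map_zero_eq_one' := by simp
  map_add_eq_mul' a b := by
    rw [ZMod.val_add, ← neg_one_pow_eq_pow_mod_two, pow_add]

lemma signChar_apply (z : ZMod 2) : signChar z = (-1) ^ z.val := rfl

lemma signChar_sum {ι : Type*} (t : Finset ι) (z : ι → ZMod 2) :
    signChar (∑ i ∈ t, z i) = ∏ i ∈ t, signChar (z i) := by
  classical
  induction t using Finset.induction_on with
  | empty => simp
  | insert i t hi ih =>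
    rw [Finset.sum_insert hi, Finset.prod_insert hi, AddChar.map_add_eq_mul, ih]

lemma zmod_two_eq (z : ZMod 2) : z = 0 ∨ z = 1 := by
  revert z; decide

lemma signChar_eq_neg_one {z : ZMod 2} (hz : z ≠ 0) : signChar z = -1 := by
  rcases zmod_two_eq z with rfl | rfl
  · exact absurd rfl hz
  · simp [signChar_apply, ZMod.val_one]

section Net

variable {s m n : ℕ} (C : Fin s → Matrix (Fin n) (Fin m) (ZMod 2))

/-- The binary digits of the coordinates of the points of a digital net. -/
def netDigit (h : Fin (2 ^ m)) (i : Fin s) (j : Fin n) : ZMod 2 :=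
  ∑ l : Fin m, (if (h : ℕ).testBit (l : ℕ) then (1 : ZMod 2) else 0) * C i j l

lemma netPoint_eq (h : Fin (2 ^ m)) (i : Fin s) :
    netPoint C h i = ∑ j ∈ range n,
      ((if hj : j < n then (netDigit C h i ⟨j, hj⟩).val else 0 : ℕ) : ℝ) *
        ((2 : ℝ) ^ (j + 1))⁻¹ := by
  rw [Finset.sum_range]
  simp [netPoint, netDigit]

lemma netDigit_val_le (h : Fin (2 ^ m)) (i : Fin s) (j : ℕ) :
    (if hj : j < n then (netDigit C h i ⟨j, hj⟩).val else 0) ≤ 1 := by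
  split_ifs
  · exact Nat.le_of_lt_succ (ZMod.val_lt _)
  · exact zero_le_one

lemma netPoint_mem (h : Fin (2 ^ m)) (i : Fin s) : netPoint C h i ∈ Set.Ico (0 : ℝ) 1 := by
  rw [netPoint_eq]
  exact binary_mem_Ico (netDigit_val_le C h i) n

lemma walsh_netPoint (h : Fin (2 ^ m)) (i : Fin s) (k : ℕ) :
    walsh k (netPoint C h i) = signChar (∑ j : Fin n,
      netDigit C h i j * if k.testBit j then 1 else 0) := by
  have hk : k < 2 ^ (n + k) :=
    Nat.lt_two_pow_self.trans_le (Nat.pow_le_pow_right (by norm_num) (by omega))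
  rw [walsh_eq_prod hk (netPoint_mem C h i).1, signChar_sum, netPoint_eq,
    Finset.prod_range_add]
  have h2 : ∀ j ∈ range k, (if k.testBit (n + j) then
      rad (n + j) (∑ j ∈ range n,
        ((if hj : j < n then (netDigit C h i ⟨j, hj⟩).val else 0 : ℕ) : ℝ) *
          ((2 : ℝ) ^ (j + 1))⁻¹) else 1) = 1 := by
    intro j _
    rw [rad_binary n (n + j) (netDigit_val_le C h i)]
    simp
  rw [Finset.prod_eq_one h2, mul_one, Finset.prod_range]
  refine Finset.prod_congr rfl fun j _ => ?_
  rw [rad_binary n j (netDigit_val_le C h i)]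
  split_ifs <;> simp_all [signChar_apply]

lemma walshV_netPoint (h : Fin (2 ^ m)) (k : Fin s → ℕ) :
    walshV k (netPoint C h) = ∏ l : Fin m, if (h : ℕ).testBit l then
      signChar (∑ i, ∑ j : Fin n, C i j l * (if (k i).testBit (j : ℕ) then 1 else 0)) else 1 := by
  have e : ∑ i, ∑ j : Fin n, netDigit C h i j * (if (k i).testBit j then 1 else 0) =
      ∑ l : Fin m, (if (h : ℕ).testBit l then 1 else 0) *
        ∑ i, ∑ j : Fin n, C i j l * (if (k i).testBit (j : ℕ) then 1 else 0) := by
    simp only [netDigit, Finset.sum_mul, Finset.mul_sum]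
    rw [Finset.sum_comm (s := (univ : Finset (Fin m)))]
    refine Finset.sum_congr rfl fun i _ => ?_
    rw [Finset.sum_comm (s := (univ : Finset (Fin m)))]
    exact Finset.sum_congr rfl fun j _ => Finset.sum_congr rfl fun l _ => mul_assoc _ _ _
  unfold walshV
  simp only [walsh_netPoint]
  rw [← signChar_sum, e, signChar_sum]
  refine Finset.prod_congr rfl fun l _ => ?_
  split_ifs <;> simp

open Classical in
lemma sum_walshV_netPoint (k : Fin s → ℕ) :
    ∑ h, walshV k (netPoint C h) = if inDual C k then (2 : ℝ) ^ m else 0 := by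
  simp only [walshV_netPoint]
  rw [sum_prod_testBit_fin]
  split_ifs with hk
  · have : ∀ l : Fin m, (1 : ℝ) + signChar (∑ i, ∑ j : Fin n,
        C i j l * (if (k i).testBit (j : ℕ) then 1 else 0)) = 2 := by
      intro l
      rw [hk l, AddChar.map_zero_eq_one]; norm_num
    simp only [this, Finset.prod_const, Finset.card_univ, Fintype.card_fin]
  · unfold inDual at hk
    push Not at hk
    obtain ⟨l, hl⟩ := hk
    refine Finset.prod_eq_zero (mem_univ l) ?_
    rw [signChar_eq_neg_one hl]; norm_num

end Net

section Cube

variable {s : ℕ}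

instance isProbabilityMeasure_restrict_Ico :
    IsProbabilityMeasure (volume.restrict (Set.Ico (0 : ℝ) 1)) := ⟨by simp⟩

lemma restrict_unitCube (s : ℕ) : volume.restrict (unitCube s) =
    Measure.pi fun _ : Fin s => volume.restrict (Set.Ico (0 : ℝ) 1) := by
  rw [unitCube, volume_pi, Measure.restrict_pi_pi]

instance isProbabilityMeasure_restrict_unitCube (s : ℕ) :
    IsProbabilityMeasure (volume.restrict (unitCube s)) := by
  rw [restrict_unitCube]; infer_instance

lemma intervalIntegral_eq_integral_Ico (F : ℝ → ℝ) :
    ∫ x in (0 : ℝ)..1, F x = ∫ x in Set.Ico (0 : ℝ) 1, F x := by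
  rw [intervalIntegral.integral_of_le zero_le_one, integral_Ico_eq_integral_Ioc]

lemma unitCube_subset_closedCube (s : ℕ) : unitCube s ⊆ closedCube s :=
  Set.pi_mono fun _ _ => Set.Ico_subset_Icc_self

lemma measurableSet_unitCube (s : ℕ) : MeasurableSet (unitCube s) :=
  MeasurableSet.univ_pi fun _ => measurableSet_Ico

lemma isCompact_closedCube (s : ℕ) : IsCompact (closedCube s) :=
  isCompact_univ_pi fun _ => isCompact_Icc

/-- Resampling the coordinates outside `v` preserves a product of probability measures. -/
lemma measurePreserving_resample (v : Finset (Fin s)) :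
    MeasurePreserving (fun (z : (Fin s → ℝ) × (Fin s → ℝ)) i => if i ∈ v then z.1 i else z.2 i)
      ((volume.restrict (unitCube s)).prod (volume.restrict (unitCube s)))
      (volume.restrict (unitCube s)) := by
  have hm : Measurable
      (fun (z : (Fin s → ℝ) × (Fin s → ℝ)) i => if i ∈ v then z.1 i else z.2 i) := by
    refine measurable_pi_iff.2 fun i => ?_
    by_cases h : i ∈ v
    · simp only [h, if_true]; exact (measurable_pi_apply i).comp measurable_fst
    · simp only [h, if_false]; exact (measurable_pi_apply i).comp measurable_snd
  refine ⟨hm, ?_⟩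
  simp only [restrict_unitCube]
  refine (Measure.pi_eq fun B hB => ?_).symm
  rw [Measure.map_apply hm (MeasurableSet.univ_pi hB)]
  have e : (fun (z : (Fin s → ℝ) × (Fin s → ℝ)) i => if i ∈ v then z.1 i else z.2 i) ⁻¹'
      Set.univ.pi B = (Set.univ.pi fun i => if i ∈ v then B i else Set.univ) ×ˢ
        (Set.univ.pi fun i => if i ∈ v then Set.univ else B i) := by
    ext z
    simp only [Set.mem_preimage, Set.mem_pi, Set.mem_univ, true_imp_iff, Set.mem_prod]
    rw [← forall_and]
    refine forall_congr' fun i => ?_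
    split_ifs <;> simp
  rw [e, Measure.prod_prod, Measure.pi_pi, Measure.pi_pi, ← Finset.prod_mul_distrib]
  refine Finset.prod_congr rfl fun i _ => ?_
  split_ifs <;> simp

/-- Resampling a single coordinate preserves a product of probability measures. -/
lemma measurePreserving_update (i : Fin s) :
    MeasurePreserving (fun z : (Fin s → ℝ) × ℝ => Function.update z.1 i z.2)
      ((volume.restrict (unitCube s)).prod (volume.restrict (Set.Ico (0 : ℝ) 1)))
      (volume.restrict (unitCube s)) := by
  have hm : Measurable (fun z : (Fin s → ℝ) × ℝ => Function.update z.1 i z.2) := by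
    refine measurable_pi_iff.2 fun j => ?_
    by_cases h : j = i
    · subst h; simpa using measurable_snd
    · simp only [Function.update_of_ne h]; exact (measurable_pi_apply j).comp measurable_fst
  refine ⟨hm, ?_⟩
  simp only [restrict_unitCube]
  refine (Measure.pi_eq fun B hB => ?_).symm
  rw [Measure.map_apply hm (MeasurableSet.univ_pi hB)]
  have e : (fun z : (Fin s → ℝ) × ℝ => Function.update z.1 i z.2) ⁻¹' Set.univ.pi B =
      (Set.univ.pi fun j => if j = i then Set.univ else B j) ×ˢ B i := by
    ext z
    simp only [Set.mem_preimage, Set.mem_pi, Set.mem_univ, true_imp_iff, Set.mem_prod]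
    constructor
    · refine fun h => ⟨fun j => ?_, by simpa using h i⟩
      split_ifs with hj
      · trivial
      · simpa [Function.update_of_ne hj] using h j
    · rintro ⟨h1, h2⟩ j
      by_cases hj : j = i
      · subst hj; simpa using h2
      · simpa [hj] using h1 j
  rw [e, Measure.prod_prod, Measure.pi_pi, ← Finset.mul_prod_erase univ _ (mem_univ i),
    ← Finset.mul_prod_erase univ _ (mem_univ i), mul_comm]
  simp only [if_true, measure_univ, one_mul]
  congr 1
  refine Finset.prod_congr rfl fun j hj => ?_
  rw [if_neg (Finset.ne_of_mem_erase hj)]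

lemma integral_eq_integral_update {F : (Fin s → ℝ) → ℝ}
    (hF : IntegrableOn F (unitCube s)) (i : Fin s) :
    ∫ x in unitCube s, F x =
      ∫ x in unitCube s, ∫ t in Set.Ico (0 : ℝ) 1, F (Function.update x i t) := by
  have hp := measurePreserving_update (s := s) i
  have hF' : Integrable F (Measure.map (fun z : (Fin s → ℝ) × ℝ => Function.update z.1 i z.2)
      ((volume.restrict (unitCube s)).prod (volume.restrict (Set.Ico (0 : ℝ) 1)))) := by
    rw [hp.map_eq]; exact hF
  conv_lhs => rw [← hp.map_eq, integral_map hp.aemeasurable hF'.aestronglyMeasurable]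
  exact integral_prod _ (hF'.comp_aemeasurable hp.aemeasurable)

lemma integrable_resample {F : (Fin s → ℝ) → ℝ} (hF : IntegrableOn F (unitCube s))
    (v : Finset (Fin s)) :
    Integrable (fun z : (Fin s → ℝ) × (Fin s → ℝ) => F fun i => if i ∈ v then z.1 i else z.2 i)
      ((volume.restrict (unitCube s)).prod (volume.restrict (unitCube s))) :=
  (measurePreserving_resample v).integrable_comp_of_integrable hF

lemma integral_eq_integral_resample {F : (Fin s → ℝ) → ℝ}
    (hF : IntegrableOn F (unitCube s)) (v : Finset (Fin s)) :
    ∫ x in unitCube s, F x = ∫ x in unitCube s, projInt v F x := by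
  have hp := measurePreserving_resample v
  conv_lhs => rw [← hp.map_eq, integral_map hp.aemeasurable
    (by rw [hp.map_eq]; exact hF.aestronglyMeasurable)]
  exact integral_prod _ (integrable_resample hF v)

lemma measurable_prod_apply {ψ : Fin s → ℝ → ℝ} (hm : ∀ i, Measurable (ψ i)) :
    Measurable fun x : Fin s → ℝ => ∏ i, ψ i (x i) :=
  Finset.measurable_fun_prod _ fun i _ => (hm i).comp (measurable_pi_apply i)

lemma integrableOn_unitCube {F : (Fin s → ℝ) → ℝ} (hF : ContinuousOn F (closedCube s)) :
    IntegrableOn F (unitCube s) :=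
  (hF.integrableOn_compact (isCompact_closedCube s)).mono_set (unitCube_subset_closedCube s)

lemma integrableOn_mul_prod {F : (Fin s → ℝ) → ℝ} (hF : ContinuousOn F (closedCube s))
    {ψ : Fin s → ℝ → ℝ} {b : Fin s → ℝ} (hm : ∀ i, Measurable (ψ i))
    (hb : ∀ i x, |ψ i x| ≤ b i) :
    IntegrableOn (fun x => F x * ∏ i, ψ i (x i)) (unitCube s) := by
  refine (integrableOn_unitCube hF).mul_bdd (c := ∏ i, b i)
    (measurable_prod_apply hm).aestronglyMeasurable (Filter.Eventually.of_forall fun x => ?_)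
  rw [Real.norm_eq_abs, Finset.abs_prod]
  exact Finset.prod_le_prod (fun _ _ => abs_nonneg _) fun i _ => hb i _

lemma update_mem_closedCube {x : Fin s → ℝ} (hx : x ∈ closedCube s) (i : Fin s) {t : ℝ}
    (ht : t ∈ Set.Icc (0 : ℝ) 1) : Function.update x i t ∈ closedCube s := by
  intro j _
  by_cases hj : j = i
  · subst hj; simpa using ht
  · simpa [Function.update_of_ne hj] using hx j trivial

/-- Applying the one-dimensional kernels in every coordinate. -/
lemma integral_mul_prod_eq_integral_deriv {u : Fin s → ℕ} {f : (Fin s → ℝ) → ℝ}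
    {D : (Fin s → ℕ) → (Fin s → ℝ) → ℝ} (hf : HasMixedDerivs u f D)
    {φ w : Fin s → ℝ → ℝ} {r : Fin s → ℕ} {B c : Fin s → ℝ} (hr : ∀ i, r i ≤ u i)
    (hw : ∀ i, IsDerivKernel (φ i) (r i) (B i) (c i) (w i))
    (hφm : ∀ i, Measurable (φ i)) (hφ : ∀ i x, |φ i x| ≤ 1) :
    ∫ x in unitCube s, f x * ∏ i, φ i (x i) = ∫ x in unitCube s, D r x * ∏ i, w i (x i) := by
  set ν : Finset (Fin s) → Fin s → ℕ := fun t i => if i ∈ t then r i else 0 with hν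
  set ψ : Finset (Fin s) → Fin s → ℝ → ℝ := fun t i => if i ∈ t then w i else φ i with hψ
  have hνu : ∀ t i, ν t i ≤ u i := by
    intro t i
    simp only [hν]
    split_ifs
    · exact hr i
    · exact Nat.zero_le _
  have hψm : ∀ t i, Measurable (ψ t i) := by
    intro t i
    simp only [hψ]
    split_ifs
    · exact (hw i).measurable
    · exact hφm i
  have hψb : ∀ t i x, |ψ t i x| ≤ max 1 (B i) := by
    intro t i x
    simp only [hψ]
    split_ifs
    · exact ((hw i).abs_le x).trans (le_max_right _ _)
    · exact (hφ i x).trans (le_max_left _ _)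
  have hint : ∀ t, IntegrableOn (fun x => D (ν t) x * ∏ i, ψ t i (x i)) (unitCube s) :=
    fun t => integrableOn_mul_prod (hf.2.1 _ (hνu t)) (hψm t) (hψb t)
  have claim : ∀ t : Finset (Fin s), ∫ x in unitCube s, f x * ∏ i, φ i (x i) =
      ∫ x in unitCube s, D (ν t) x * ∏ i, ψ t i (x i) := by
    intro t
    induction t using Finset.induction_on with
    | empty =>
      have h0 : D (ν ∅) = f := by rw [← hf.1]; congr 1
      rw [h0]
      simp [hψ]
    | insert i t hi ih =>
      rw [ih, integral_eq_integral_update (hint t) i,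
        integral_eq_integral_update (hint (insert i t)) i]
      refine setIntegral_congr_fun (measurableSet_unitCube s) fun x hx => ?_
      have hx := unitCube_subset_closedCube s hx
      have hprod : ∀ t' τ, ∏ j, ψ t' j (Function.update x i τ j) =
          ψ t' i τ * ∏ j ∈ univ.erase i, ψ t' j (x j) := by
        intro t' τ
        rw [← Finset.mul_prod_erase univ _ (mem_univ i), Function.update_self]
        congr 1
        refine Finset.prod_congr rfl fun j hj => ?_
        rw [Function.update_of_ne (Finset.ne_of_mem_erase hj)]
      have hrest : ∏ j ∈ univ.erase i, ψ (insert i t) j (x j) =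
          ∏ j ∈ univ.erase i, ψ t j (x j) := by
        refine Finset.prod_congr rfl fun j hj => ?_
        simp [hψ, Finset.ne_of_mem_erase hj]
      have hψt : ψ t i = φ i := by simp [hψ, hi]
      have hψi : ψ (insert i t) i = w i := by simp [hψ]
      simp only [hprod, hrest, hψt, hψi, ← mul_assoc]
      rw [integral_mul_const, integral_mul_const, ← intervalIntegral_eq_integral_Ico,
        ← intervalIntegral_eq_integral_Ico]
      congr 1
      have hu : ∀ j ≤ r i, ∀ l, Function.update (ν t) i j l ≤ u l := by
        intro j hj l
        by_cases hl : l = i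
        · subst hl; simpa using hj.trans (hr l)
        · simpa [Function.update_of_ne hl] using hνu t l
      have h := (hw i).integral_eq
        (fun j τ => D (Function.update (ν t) i j) (Function.update x i τ))
        (fun j hj => (hf.2.1 _ (hu j hj)).comp
          (show Continuous (Function.update x i) from
            continuous_const.update i continuous_id).continuousOn
          fun τ hτ => update_mem_closedCube hx i hτ)
        (fun j hj τ hτ => by
          have e : addE i (Function.update (ν t) i j) = Function.update (ν t) i (j + 1) := by
            simp [addE]
          have := hf.2.2 (Function.update (ν t) i j) i (by rw [e]; exact hu _ hj) _
            (update_mem_closedCube hx i hτ)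
          simpa only [e, Function.update_idem, Function.update_self] using this)
      have e0 : Function.update (ν t) i 0 = ν t := by
        rw [Function.update_eq_self_iff]; simp [hν, hi]
      have e1 : Function.update (ν t) i (r i) = ν (insert i t) := by
        ext j
        by_cases hj : j = i
        · subst hj; simp [hν]
        · simp [hν, hj]
      rwa [e0, e1] at h
  rw [claim univ]
  simp [hν, hψ]

end Cube

lemma lintegral_enorm_mul_le {Ω : Type*} [MeasurableSpace Ω] {μ : Measure Ω} {g : Ω → ℝ}
    (hg : AEStronglyMeasurable g μ) {W : Ω → ℝ≥0∞} (hWm : Measurable W) {K : ℝ≥0∞}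
    (hK : K ≠ 0) (hW : ∀ x, W x ≤ K) (hW1 : ∫⁻ x, W x ∂μ ≤ 1) {p : ℝ≥0∞} (hp : 1 ≤ p) :
    ∫⁻ x, ‖g x‖ₑ * W x ∂μ ≤ K ^ (1 / p).toReal * eLpNorm g p μ := by
  have hac : μ.withDensity W ≪ μ := withDensity_absolutelyContinuous μ W
  have hle : μ.withDensity W ≤ K • μ := by
    rw [← withDensity_const]
    exact withDensity_mono (Filter.Eventually.of_forall hW)
  have h1 : ∫⁻ x, ‖g x‖ₑ * W x ∂μ = eLpNorm g 1 (μ.withDensity W) := by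
    rw [eLpNorm_one_eq_lintegral_enorm, lintegral_withDensity_eq_lintegral_mul₀'
      hWm.aemeasurable (hg.mono_ac hac).enorm]
    simp [mul_comm]
  have h2 : (μ.withDensity W) Set.univ ≤ 1 := by
    rwa [withDensity_apply _ MeasurableSet.univ, Measure.restrict_univ]
  calc ∫⁻ x, ‖g x‖ₑ * W x ∂μ = eLpNorm g 1 (μ.withDensity W) := h1
    _ ≤ eLpNorm g p (μ.withDensity W) *
        (μ.withDensity W) Set.univ ^ (1 / (1 : ℝ≥0∞).toReal - 1 / p.toReal) :=
      eLpNorm_le_eLpNorm_mul_rpow_measure_univ hp (hg.mono_ac hac)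
    _ ≤ eLpNorm g p (μ.withDensity W) * 1 := by
      gcongr
      refine ENNReal.rpow_le_one h2 ?_
      rcases eq_or_ne p ∞ with rfl | hpt
      · simp
      · have : 1 ≤ p.toReal := by
          rw [← ENNReal.toReal_one]; exact ENNReal.toReal_mono hpt hp
        have h3 : 1 / p.toReal ≤ 1 := by
          rw [div_le_one (by linarith)]; exact this
        simpa using h3
    _ ≤ eLpNorm g p (K • μ) := by
      rw [mul_one]; exact eLpNorm_mono_measure g hle
    _ = K ^ (1 / p).toReal * eLpNorm g p μ := by
      rw [eLpNorm_smul_measure_of_ne_zero hK, smul_eq_mul]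

section WalshCoeff

variable {s : ℕ}

lemma lintegral_prod_enorm_le {w : Fin s → ℝ → ℝ} {B c : Fin s → ℝ}
    (hm : ∀ i, Measurable (w i)) (hb : ∀ i x, |w i x| ≤ B i)
    (hc : ∀ i, ∫ x in (0 : ℝ)..1, |w i x| ≤ c i) :
    ∫⁻ x in unitCube s, ‖∏ i, w i (x i)‖ₑ ≤ ENNReal.ofReal (∏ i, c i) := by
  have hint : IntegrableOn (fun x : Fin s → ℝ => (1 : ℝ) * ∏ i, w i (x i)) (unitCube s) :=
    integrableOn_mul_prod continuousOn_const hm hb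
  simp only [one_mul] at hint
  rw [← ofReal_integral_norm_eq_lintegral_enorm hint]
  refine ENNReal.ofReal_le_ofReal ?_
  simp only [norm_prod]
  rw [restrict_unitCube]
  rw [integral_fintype_prod_eq_prod (𝕜 := ℝ) (fun i t => ‖w i t‖)]
  refine Finset.prod_le_prod (fun i _ => integral_nonneg fun _ => norm_nonneg _) fun i _ => ?_
  have := hc i
  rwa [intervalIntegral_eq_integral_Ico] at this

lemma two_pow_neg_muWV (α : ℕ) (k : Fin s → ℕ) :
    (2 : ℝ≥0∞) ^ (-(muWV (fun _ => α) k : ℝ)) =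
      ENNReal.ofReal (∏ i, ((2 : ℝ) ^ muW α (k i))⁻¹) := by
  rw [Finset.prod_inv_distrib, Finset.prod_pow_eq_pow_sum, ENNReal.ofReal_inv_of_pos
    (by positivity), ENNReal.ofReal_pow (by norm_num), ENNReal.rpow_neg, ENNReal.rpow_natCast]
  simp [muWV]

lemma enorm_walshCoeff_le {α : ℕ} {f : (Fin s → ℝ) → ℝ}
    {D : (Fin s → ℕ) → (Fin s → ℝ) → ℝ} (hf : HasMixedDerivs (fun _ => α) f D)
    {p : ℝ≥0∞} (hp : 1 ≤ p) (k : Fin s → ℕ) {v : Finset (Fin s)} (hv : ∀ i, i ∈ v ↔ k i ≠ 0) :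
    ‖walshCoeff f k‖ₑ ≤ (2 : ℝ≥0∞) ^ ((v.card : ℝ) / p.toReal) *
      mixedNorm p v (D fun i => min α (numBits (k i))) *
        (2 : ℝ≥0∞) ^ (-(muWV (fun _ => α) k : ℝ)) := by
  choose w hw hw1 using fun i => exists_isDerivKernel_walsh α (k := k i)
  set r : Fin s → ℕ := fun i => min α (numBits (k i)) with hr
  set c : ℝ≥0∞ := (2 : ℝ≥0∞) ^ (-(muWV (fun _ => α) k : ℝ)) with hc
  have hc' := two_pow_neg_muWV α k
  rw [← hc] at hc'
  have hc0 : c ≠ 0 := by rw [hc', Ne, ENNReal.ofReal_eq_zero, not_le]; positivity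
  have hct : c ≠ ∞ := by rw [hc']; exact ENNReal.ofReal_ne_top
  have hra : ∀ i, r i ≤ α := fun i => min_le_left _ _
  have hDc := hf.2.1 r hra
  have h1 : walshCoeff f k = ∫ x in unitCube s, D r x * ∏ i, w i (x i) :=
    integral_mul_prod_eq_integral_deriv hf hra hw (fun i => measurable_walsh _)
      fun i x => (abs_walsh _ _).le
  have hint := integrableOn_mul_prod hDc (fun i => (hw i).measurable) fun i => (hw i).abs_le
  have hprod : ∀ x y : Fin s → ℝ, ∏ i, w i (if i ∈ v then x i else y i) = ∏ i, w i (x i) := by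
    intro x y
    refine Finset.prod_congr rfl fun i _ => ?_
    split_ifs with hi
    · rfl
    · have : k i = 0 := by simpa [hv] using hi
      rw [hw1 i this, hw1 i this]
  have h2 : walshCoeff f k = ∫ x in unitCube s, projInt v (D r) x * ∏ i, w i (x i) := by
    rw [h1, integral_eq_integral_resample hint v]
    congr 1
    ext x
    simp only [projInt, hprod]
    rw [integral_mul_const]
  have hg : AEStronglyMeasurable (projInt v (D r)) (volume.restrict (unitCube s)) :=
    (integrable_resample (integrableOn_unitCube hDc) v).aestronglyMeasurable.integral_prod_right'
  have hWm : Measurable fun x : Fin s → ℝ => ‖∏ i, w i (x i)‖ₑ :=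
    (measurable_prod_apply fun i => (hw i).measurable).enorm
  have hWb : ∀ x : Fin s → ℝ, ‖∏ i, w i (x i)‖ₑ ≤ 2 ^ v.card * c := by
    intro x
    have e : ∏ i, (if k i = 0 then (1 : ℝ) else 2 * ((2 : ℝ) ^ muW α (k i))⁻¹) =
        2 ^ v.card * ∏ i, ((2 : ℝ) ^ muW α (k i))⁻¹ := by
      have : (2 : ℝ) ^ v.card = ∏ i, if k i = 0 then (1 : ℝ) else 2 := by
        have hv' : v = univ.filter fun i => ¬ k i = 0 := by ext i; simp [hv]
        rw [Finset.prod_ite, hv']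
        simp
      rw [this, ← Finset.prod_mul_distrib]
      refine Finset.prod_congr rfl fun i _ => ?_
      split_ifs with h
      · simp [h, muW_zero_right]
      · rfl
    have e2 : (2 : ℝ≥0∞) ^ v.card = ENNReal.ofReal (2 ^ v.card) := by
      rw [ENNReal.ofReal_pow (by norm_num)]; simp
    rw [hc', e2, ← ENNReal.ofReal_mul (by positivity), ← e, Real.enorm_eq_ofReal_abs,
      Finset.abs_prod]
    exact ENNReal.ofReal_le_ofReal
      (Finset.prod_le_prod (fun _ _ => abs_nonneg _) fun i _ => (hw i).abs_le _)
  have hWi : ∫⁻ x in unitCube s, ‖∏ i, w i (x i)‖ₑ ≤ c := by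
    rw [hc']
    exact lintegral_prod_enorm_le (fun i => (hw i).measurable) (fun i => (hw i).abs_le)
      fun i => (hw i).integral_abs_le
  have key := lintegral_enorm_mul_le hg (W := fun x => ‖∏ i, w i (x i)‖ₑ * c⁻¹)
    (hWm.mul_const _) (K := 2 ^ v.card) (by positivity)
    (fun x => by rw [← div_eq_mul_inv]; exact ENNReal.div_le_of_le_mul (hWb x))
    (by
      rw [lintegral_mul_const _ hWm, ← div_eq_mul_inv]
      exact ENNReal.div_le_of_le_mul (by rwa [one_mul])) hp
  have hexp : ((2 : ℝ≥0∞) ^ v.card) ^ (1 / p).toReal = 2 ^ ((v.card : ℝ) / p.toReal) := by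
    rw [← ENNReal.rpow_natCast, ← ENNReal.rpow_mul, one_div, ENNReal.toReal_inv, div_eq_mul_inv]
  rw [hexp] at key
  calc ‖walshCoeff f k‖ₑ
      ≤ ∫⁻ x in unitCube s, ‖projInt v (D r) x * ∏ i, w i (x i)‖ₑ := by
        rw [h2]; exact enorm_integral_le_lintegral_enorm _
    _ = (∫⁻ x in unitCube s, ‖projInt v (D r) x‖ₑ * (‖∏ i, w i (x i)‖ₑ * c⁻¹)) * c := by
        rw [← lintegral_mul_const' _ _ hct]
        refine lintegral_congr fun x => ?_
        rw [enorm_mul, mul_assoc, mul_assoc, ENNReal.inv_mul_cancel hc0 hct, mul_one]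
    _ ≤ _ := by gcongr; exact key

end WalshCoeff

section KoksmaHlawka

variable {s : ℕ}

lemma sum_walshCoeff_mul_walshV {f : (Fin s → ℝ) → ℝ} (hf : ContinuousOn f (closedCube s))
    (N : ℕ) {x : Fin s → ℝ} (hx : x ∈ unitCube s) :
    ∑ k ∈ Fintype.piFinset (fun _ : Fin s => range (2 ^ N)), walshCoeff f k * walshV k x =
      ∫ y in unitCube s, f y * ∏ i, dirichlet N (x i) (y i) := by
  have hint : ∀ k : Fin s → ℕ, IntegrableOn (fun y => f y * walshV k y) (unitCube s) := fun k =>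
    integrableOn_mul_prod hf (fun i => measurable_walsh (k i)) fun i y => (abs_walsh (k i) y).le
  simp only [walshCoeff, ← integral_mul_const]
  rw [← integral_finsetSum _ fun k _ => (hint k).mul_const _]
  refine setIntegral_congr_fun (measurableSet_unitCube s) fun y hy => ?_
  simp only [mul_assoc, ← Finset.mul_sum]
  congr 1
  simp only [walshV, ← Finset.prod_mul_distrib]
  rw [← Finset.prod_univ_sum (fun _ => range (2 ^ N)) fun i j => walsh j (y i) * walsh j (x i)]
  refine Finset.prod_congr rfl fun i _ => ?_
  rw [← sum_walsh_mul_walsh N (hx i trivial).1 (hy i trivial).1]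
  exact Finset.sum_congr rfl fun k _ => mul_comm _ _

lemma integral_prod_dirichlet (N : ℕ) {x : Fin s → ℝ} (hx : x ∈ unitCube s) :
    ∫ y in unitCube s, ∏ i, dirichlet N (x i) (y i) = 1 := by
  rw [restrict_unitCube, integral_fintype_prod_eq_prod (𝕜 := ℝ) fun i t => dirichlet N (x i) t]
  refine Finset.prod_eq_one fun i _ => ?_
  rw [← intervalIntegral_eq_integral_Ico, integral_dirichlet N (hx i trivial).1]

/-- The dyadic Walsh partial sums of a continuous function converge uniformly. -/
lemma exists_abs_sum_walshCoeff_sub_le {f : (Fin s → ℝ) → ℝ}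
    (hf : ContinuousOn f (closedCube s)) {ε : ℝ} (hε : 0 < ε) :
    ∃ N : ℕ, ∀ x ∈ unitCube s,
      |∑ k ∈ Fintype.piFinset (fun _ : Fin s => range (2 ^ N)), walshCoeff f k * walshV k x -
        f x| ≤ ε := by
  obtain ⟨δ, hδ, h⟩ := Metric.uniformContinuousOn_iff.1
    ((isCompact_closedCube s).uniformContinuousOn_of_continuous hf) ε hε
  obtain ⟨N, hN⟩ := exists_pow_lt_of_lt_one hδ (by norm_num : (2 : ℝ)⁻¹ < 1)
  rw [inv_pow] at hN
  refine ⟨N, fun x hx => ?_⟩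
  have hm : ∀ i, Measurable (dirichlet N (x i)) := fun i => measurable_dirichlet N (x i)
  have hb : ∀ i y, |dirichlet N (x i) y| ≤ 2 ^ N := fun i y => by
    rw [abs_of_nonneg (dirichlet_nonneg _ _ _)]; exact dirichlet_le _ _ _
  have hint := integrableOn_mul_prod hf hm hb
  have hconst : ∀ c : ℝ,
      IntegrableOn (fun y : Fin s → ℝ => c * ∏ i, dirichlet N (x i) (y i)) (unitCube s) :=
    fun c => integrableOn_mul_prod continuousOn_const hm hb
  have hI : ∀ c : ℝ, ∫ y in unitCube s, c * ∏ i, dirichlet N (x i) (y i) = c := fun c => by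
    rw [integral_const_mul, integral_prod_dirichlet N hx, mul_one]
  rw [sum_walshCoeff_mul_walshV hf N hx, ← hI (f x), ← integral_sub hint (hconst (f x)),
    ← Real.norm_eq_abs, ← hI ε]
  refine norm_integral_le_of_norm_le (hconst ε)
    ((ae_restrict_iff' (measurableSet_unitCube s)).2 (Filter.Eventually.of_forall fun y hy => ?_))
  have hP : 0 ≤ ∏ i, dirichlet N (x i) (y i) :=
    Finset.prod_nonneg fun i _ => dirichlet_nonneg _ _ _
  rw [← sub_mul, Real.norm_eq_abs, abs_mul, abs_of_nonneg hP]
  by_cases h0 : ∏ i, dirichlet N (x i) (y i) = 0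
  · simp [h0]
  · refine mul_le_mul_of_nonneg_right ?_ hP
    rw [← ne_eq, Finset.prod_ne_zero_iff] at h0
    refine (h y (unitCube_subset_closedCube s hy) x (unitCube_subset_closedCube s hx) ?_).le
    refine (dist_pi_lt_iff hδ).2 fun i => ?_
    rw [Real.dist_eq]
    exact (abs_sub_lt_of_dirichlet_ne_zero (hx i trivial) (hy i trivial)
      (h0 i (mem_univ i))).trans hN

lemma walshCoeff_zero (f : (Fin s → ℝ) → ℝ) :
    walshCoeff f (fun _ => 0) = ∫ x in unitCube s, f x := by
  simp [walshCoeff, walshV, walsh_zero]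

open Classical in
/-- The quadrature error of a digital net is bounded by the Walsh coefficients on the dual net. -/
lemma exists_ofReal_abs_error_le {m n : ℕ} (C : Fin s → Matrix (Fin n) (Fin m) (ZMod 2))
    {f : (Fin s → ℝ) → ℝ} (hf : ContinuousOn f (closedCube s)) {ε : ℝ} (hε : 0 < ε) :
    ∃ N : ℕ, ENNReal.ofReal
        |(∫ x in unitCube s, f x) - ((2 : ℝ) ^ m)⁻¹ * ∑ h : Fin (2 ^ m), f (netPoint C h)| ≤
      (∑ k ∈ Fintype.piFinset (fun _ : Fin s => range (2 ^ N)),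
        if inDual C k ∧ k ≠ (fun _ => 0) then ‖walshCoeff f k‖ₑ else 0) + ENNReal.ofReal ε := by
  obtain ⟨N, hN⟩ := exists_abs_sum_walshCoeff_sub_le hf hε
  refine ⟨N, ?_⟩
  set box := Fintype.piFinset (fun _ : Fin s => range (2 ^ N)) with hbox
  set S : (Fin s → ℝ) → ℝ := fun x => ∑ k ∈ box, walshCoeff f k * walshV k x with hS
  have hcard : (0 : ℝ) < 2 ^ m := by positivity
  have h1 : ((2 : ℝ) ^ m)⁻¹ * ∑ h, S (netPoint C h) =
      ∑ k ∈ box, if inDual C k then walshCoeff f k else 0 := by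
    simp only [hS]
    rw [Finset.sum_comm, Finset.mul_sum]
    refine Finset.sum_congr rfl fun k _ => ?_
    rw [← Finset.mul_sum, sum_walshV_netPoint]
    split_ifs
    · field_simp
    · simp
  have h0 : (fun _ => 0 : Fin s → ℕ) ∈ box := by simp [hbox]
  have hd0 : inDual C (fun _ => 0) := by intro l; simp
  have h2 : (∑ k ∈ box, if inDual C k then walshCoeff f k else 0) =
      (∫ x in unitCube s, f x) +
        ∑ k ∈ box, if inDual C k ∧ k ≠ (fun _ => 0) then walshCoeff f k else 0 := by
    rw [← Finset.add_sum_erase _ _ h0, if_pos hd0, walshCoeff_zero,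
      ← Finset.add_sum_erase (a := (fun _ => 0 : Fin s → ℕ)) _
        (fun k => if inDual C k ∧ k ≠ (fun _ => 0) then walshCoeff f k else 0) h0]
    simp only [ne_eq, not_true_eq_false, and_false, if_false, zero_add]
    congr 1
    refine Finset.sum_congr rfl fun k hk => ?_
    simp [Finset.ne_of_mem_erase hk]
  have h3 : |((2 : ℝ) ^ m)⁻¹ * ∑ h, S (netPoint C h) -
      ((2 : ℝ) ^ m)⁻¹ * ∑ h, f (netPoint C h)| ≤ ε := by
    rw [← mul_sub, ← Finset.sum_sub_distrib, abs_mul, abs_of_pos (inv_pos.2 hcard),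
      inv_mul_le_iff₀ hcard]
    refine (Finset.abs_sum_le_sum_abs _ _).trans ?_
    refine (Finset.sum_le_card_nsmul _ _ ε fun h _ =>
      hN _ fun i _ => netPoint_mem C h i).trans ?_
    simp
  rw [h1, h2] at h3
  set T := ∑ k ∈ box, if inDual C k ∧ k ≠ (fun _ => 0) then walshCoeff f k else 0 with hT
  have h4 : |(∫ x in unitCube s, f x) - ((2 : ℝ) ^ m)⁻¹ * ∑ h, f (netPoint C h)| ≤ |T| + ε := by
    rw [abs_le] at h3 ⊢
    constructor <;> linarith [le_abs_self T, neg_abs_le T]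
  refine (ENNReal.ofReal_le_ofReal h4).trans ?_
  rw [ENNReal.ofReal_add (abs_nonneg _) hε.le]
  gcongr
  rw [← Real.enorm_eq_ofReal_abs, hT]
  refine (enorm_sum_le _ _).trans (Finset.sum_le_sum fun k _ => ?_)
  split_ifs <;> simp

lemma one_le_numBits {k : ℕ} (hk : k ≠ 0) : 1 ≤ numBits k := by
  obtain ⟨a, k', hk', rfl⟩ := exists_eq_two_pow_add hk
  rw [numBits_two_pow_add hk']
  omega

/-- Hölder's inequality for `lqNorm`. -/
lemma sum_mul_le_lqNorm_mul_lqNorm {ι : Type*} [Fintype ι] {q q' : ℝ≥0∞}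
    (hqq' : 1 / q + 1 / q' = 1) (a b : ι → ℝ≥0∞) :
    ∑ i, a i * b i ≤ lqNorm q' a * lqNorm q b := by
  rcases eq_or_ne q ∞ with rfl | hqt
  · have h1 : q' = 1 := by simpa using hqq'
    subst h1
    simp only [lqNorm, ENNReal.one_ne_top, if_true, if_false, ENNReal.toReal_one, inv_one,
      ENNReal.rpow_one]
    rw [Finset.sum_mul]
    gcongr with i
    exact le_iSup b i
  rcases eq_or_ne q' ∞ with rfl | hqt'
  · have h1 : q = 1 := by simpa using hqq'
    subst h1
    simp only [lqNorm, ENNReal.one_ne_top, if_true, if_false, ENNReal.toReal_one, inv_one,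
      ENNReal.rpow_one]
    rw [Finset.mul_sum]
    gcongr with i
    exact le_iSup a i
  have : q'.HolderConjugate q := ⟨by simpa [add_comm] using hqq'⟩
  have hconj := ENNReal.HolderConjugate.toReal_of_ne_top hqt' hqt
  simp only [lqNorm, hqt, hqt', if_false]
  simpa only [one_div] using ENNReal.inner_le_Lp_mul_Lq univ a b hconj

open Classical in
lemma sum_enorm_walshCoeff_le {m n : ℕ} (C : Fin s → Matrix (Fin n) (Fin m) (ZMod 2)) {α : ℕ}
    (hα : 1 ≤ α) {f : (Fin s → ℝ) → ℝ} {D : (Fin s → ℕ) → (Fin s → ℝ) → ℝ}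
    (hf : HasMixedDerivs (fun _ => α) f D) {p : ℝ≥0∞} (hp : 1 ≤ p) (B : Finset (Fin s → ℕ)) :
    (∑ k ∈ B, if inDual C k ∧ k ≠ (fun _ => 0) then ‖walshCoeff f k‖ₑ else 0) ≤
      ∑ v : {v : Finset (Fin s) // v.Nonempty}, ((2 : ℝ≥0∞) ^ ((v.1.card : ℝ) / p.toReal) *
        ⨆ ν ∈ {ν : Fin s → ℕ | (∀ i ∈ v.1, 1 ≤ ν i ∧ ν i ≤ α) ∧ ∀ i ∉ v.1, ν i = 0},
          mixedNorm p v.1 (D ν)) * dualSum α C v.1 := by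
  set A : {v : Finset (Fin s) // v.Nonempty} → ℝ≥0∞ := fun v =>
    (2 : ℝ≥0∞) ^ ((v.1.card : ℝ) / p.toReal) *
        ⨆ ν ∈ {ν : Fin s → ℕ | (∀ i ∈ v.1, 1 ≤ ν i ∧ ν i ≤ α) ∧ ∀ i ∉ v.1, ν i = 0},
          mixedNorm p v.1 (D ν) with hA
  set c : (Fin s → ℕ) → ℝ≥0∞ := fun k => (2 : ℝ≥0∞) ^ (-(muWV (fun _ => α) k : ℝ)) with hc
  calc _ ≤ ∑ k ∈ B, ∑ v : {v : Finset (Fin s) // v.Nonempty},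
        A v * if (∀ i, i ∈ v.1 ↔ k i ≠ 0) ∧ inDual C k then c k else 0 := by
        refine Finset.sum_le_sum fun k _ => ?_
        split_ifs with hk
        · obtain ⟨i₀, hi₀⟩ := Function.ne_iff.1 hk.2
          have hv : ∀ i, i ∈ univ.filter (fun i => k i ≠ 0) ↔ k i ≠ 0 := by simp
          refine le_trans ?_ (Finset.single_le_sum
            (f := fun v : {v : Finset (Fin s) // v.Nonempty} =>
              A v * if (∀ i, i ∈ v.1 ↔ k i ≠ 0) ∧ inDual C k then c k else 0)
            (fun _ _ => zero_le) (mem_univ ⟨univ.filter (fun i => k i ≠ 0), ⟨i₀, (hv i₀).2 hi₀⟩⟩))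
          simp only
          rw [if_pos ⟨hv, hk.1⟩]
          refine (enorm_walshCoeff_le hf hp k hv).trans ?_
          simp only [hA, hc]
          gcongr
          refine le_iSup₂ (f := fun ν _ => mixedNorm p _ (D ν))
            (fun i => min α (numBits (k i))) ⟨fun i hi => ?_, fun i hi => ?_⟩
          · exact ⟨le_min hα (one_le_numBits ((hv i).1 hi)), min_le_left _ _⟩
          · have : k i = 0 := by simpa using hi
            simp [this, numBits_zero]
        · exact zero_le
    _ = ∑ v : {v : Finset (Fin s) // v.Nonempty}, A v *
        ∑ k ∈ B, if (∀ i, i ∈ v.1 ↔ k i ≠ 0) ∧ inDual C k then c k else 0 := by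
        rw [Finset.sum_comm]
        simp only [Finset.mul_sum]
    _ ≤ _ := by
        gcongr with v
        exact ENNReal.sum_le_tsum _

end KoksmaHlawka

/-- Theorem 1, new Koksma–Hlawka inequality:
for a digital net `P` over `𝔽₂` with `|P| = 2^m` and a function `f` whose mixed partial
derivatives up to order `α ≥ 2` in each variable are continuous on `[0,1]^s`,
`|Err(f;P)| ≤ ‖f‖_{B_α,γ,p,q'} ⋅ W_{α,γ,q}(P)`. -/
theorem stmt0 {s m n : ℕ} (hs : 1 ≤ s) (hmn : m ≤ n)
    (C : Fin s → Matrix (Fin n) (Fin m) (ZMod 2))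
    (hinj : Function.Injective (netPoint C))
    (α : ℕ) (hα : 2 ≤ α)
    (f : (Fin s → ℝ) → ℝ) (D : (Fin s → ℕ) → (Fin s → ℝ) → ℝ)
    (hf : HasMixedDerivs (fun _ => α) f D)
    (p q q' : ℝ≥0∞) (hp : 1 ≤ p) (hq : 1 ≤ q) (hq' : 1 ≤ q')
    (hqq' : 1 / q + 1 / q' = 1)
    (γ : Finset (Fin s) → ℝ) (hγ : ∀ v : Finset (Fin s), v.Nonempty → 0 < γ v) :
    ENNReal.ofReal
        |(∫ x in unitCube s, f x) - ((2 : ℝ) ^ m)⁻¹ * ∑ h : Fin (2 ^ m), f (netPoint C h)| ≤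
      lqNorm q' (fun v : {v : Finset (Fin s) // v.Nonempty} =>
          (ENNReal.ofReal (γ v.1))⁻¹ * (2 : ℝ≥0∞) ^ ((v.1.card : ℝ) / p.toReal) *
            ⨆ ν ∈ {ν : Fin s → ℕ | (∀ i ∈ v.1, 1 ≤ ν i ∧ ν i ≤ α) ∧ ∀ i ∉ v.1, ν i = 0},
              mixedNorm p v.1 (D ν)) *
        lqNorm q (fun v : {v : Finset (Fin s) // v.Nonempty} =>
          ENNReal.ofReal (γ v.1) * dualSum α C v.1) := by
  have hfc : ContinuousOn f (closedCube s) := by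
    rw [← hf.1]; exact hf.2.1 _ fun _ => Nat.zero_le _
  have key : ENNReal.ofReal
      |(∫ x in unitCube s, f x) - ((2 : ℝ) ^ m)⁻¹ * ∑ h : Fin (2 ^ m), f (netPoint C h)| ≤
      ∑ v : {v : Finset (Fin s) // v.Nonempty}, ((2 : ℝ≥0∞) ^ ((v.1.card : ℝ) / p.toReal) *
        ⨆ ν ∈ {ν : Fin s → ℕ | (∀ i ∈ v.1, 1 ≤ ν i ∧ ν i ≤ α) ∧ ∀ i ∉ v.1, ν i = 0},
          mixedNorm p v.1 (D ν)) * dualSum α C v.1 := by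
    refine ENNReal.le_of_forall_pos_le_add fun ε hε _ => ?_
    obtain ⟨N, hN⟩ := exists_ofReal_abs_error_le C hfc (NNReal.coe_pos.2 hε)
    rw [ENNReal.ofReal_coe_nnreal] at hN
    refine hN.trans ?_
    gcongr
    exact sum_enorm_walshCoeff_le C (by omega) hf hp _
  refine key.trans (le_trans (le_of_eq ?_) (sum_mul_le_lqNorm_mul_lqNorm hqq' _ _))
  refine Finset.sum_congr rfl fun v _ => ?_
  have h0 : ENNReal.ofReal (γ v.1) ≠ 0 := by
    rw [Ne, ENNReal.ofReal_eq_zero, not_le]; exact hγ v.1 v.2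
  rw [mul_assoc (ENNReal.ofReal (γ v.1))⁻¹, mul_mul_mul_comm,
    ENNReal.inv_mul_cancel h0 ENNReal.ofReal_ne_top, one_mul]

end
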